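/- arXiv:1606.03829 — 2 statements merged into one kernel-verified Lean document; each statement's English description precedes it below -/
import Mathlib

section
/- Let S = {s_1 < s_2 < ⋯ < s_k} ⊆ {1,…,n−1} and let λ be a partition of n. Then the multiplicity b_λ(S ∪ {n}) of the irreducible 𝔖_n-representation ρ^λ in β_{P_n}(S ∪ {n}) is equal to the number of pairs (w,Q) where w ∈ 𝔖_n has descent set S, Q is a standard Young tableau of shape λ, and τ(w,Q) is even. -/
open scoped Classical

noncomputable section

/-! ### Permutation combinatorics -/

/-- The value `w(i)` (1-based, in `{1,…,n}`) of a permutation `w` of `{1,…,n}`,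
realized as `Equiv.Perm (Fin n)`. -/
def permApp {n : ℕ} (w : Equiv.Perm (Fin n)) (i : ℕ) : ℕ :=
  if h : i - 1 < n then (w ⟨i - 1, h⟩ : ℕ) + 1 else 0

/-- The descent set of a permutation, a subset of `{1,…,n-1}`. -/
def descentSet {n : ℕ} (w : Equiv.Perm (Fin n)) : Finset ℕ :=
  (Finset.Icc 1 (n - 1)).filter fun i => permApp w (i + 1) < permApp w i

/-- `numDescentSet m T` is the number of permutations in `𝔖_m` with descent set `T`. -/
def numDescentSet (m : ℕ) (T : Finset ℕ) : ℕ :=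
  Nat.card {w : Equiv.Perm (Fin m) // descentSet w = T}

/-- The Coxeter length (number of inversions) of a permutation. -/
def invCount {n : ℕ} (w : Equiv.Perm (Fin n)) : ℕ :=
  (Finset.univ.filter fun p : Fin n × Fin n => p.1 < p.2 ∧ w p.2 < w p.1).card

/-- For `S = {s_1 < s_2 < ⋯ < s_k} ⊆ {1,…,n-1}`, `sElt n S j = s_j`, with the
conventions `s_0 = 0` and `s_j = n` for `j > k`. -/
def sElt (n : ℕ) (S : Finset ℕ) (j : ℕ) : ℕ :=
  if j = 0 then 0 else if j ≤ S.card then (S.sort (· ≤ ·)).getD (j - 1) 0 else n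

lemma sElt_of_gt (n : ℕ) (S : Finset ℕ) (j : ℕ) (h : S.card < j) : sElt n S j = n := by
  unfold sElt
  rw [if_neg (by omega), if_neg (by omega)]

/-! ### Standard Young tableaux -/

/-- A standard Young tableau of shape `μ`: a filling of the cells of `μ` by the numbers
`1,…,μ.card`, each used once, strictly increasing along rows and columns
(the entry of a non-cell is `0`). -/
structure SYT (μ : YoungDiagram) where
  entry : ℕ → ℕ → ℕ
  entry_eq_zero : ∀ i j, (i, j) ∉ μ → entry i j = 0
  row_strict : ∀ i j1 j2, j1 < j2 → (i, j2) ∈ μ → entry i j1 < entry i j2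
  col_strict : ∀ i1 i2 j, i1 < i2 → (i2, j) ∈ μ → entry i1 j < entry i2 j
  bijOn : Set.BijOn (fun p : ℕ × ℕ => entry p.1 p.2) ↑μ.cells ↑(Finset.Icc 1 μ.card)

/-- The descent set of a standard Young tableau: those `k` such that `k+1` lies in a
strictly lower row than `k`. -/
def SYT.des {μ : YoungDiagram} (Q : SYT μ) : Finset ℕ :=
  (Finset.Icc 1 (μ.card - 1)).filter fun k =>
    ∃ p1 ∈ μ.cells, ∃ p2 ∈ μ.cells,
      Q.entry p1.1 p1.2 = k ∧ Q.entry p2.1 p2.2 = k + 1 ∧ p1.1 < p2.1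

/-- `fSYTRow μ t` is the number of standard Young tableaux of shape `μ` whose first row
contains the numbers `1,…,t`. -/
def fSYTRow (μ : YoungDiagram) (t : ℕ) : ℕ :=
  Nat.card {Q : SYT μ // ∀ k, 1 ≤ k → k ≤ t → ∃ j, (0, j) ∈ μ ∧ Q.entry 0 j = k}

/-! ### Irreducible characters of the symmetric group, via Jacobi–Trudi -/

/-- The number of functions `f : Fin n → Fin k` which are invariant under `g` and whose
fiber over `i` has `c i` elements.  For `c` a composition of `n`, the function
`g ↦ fixedYoungFns n k c g` is the character of the permutation representation of `𝔖_n`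
on ordered set partitions of `{1,…,n}` of type `c`, i.e. of the representation induced
from the trivial representation of the corresponding Young subgroup. -/
def fixedYoungFns (n k : ℕ) (c : Fin k → ℤ) (g : Equiv.Perm (Fin n)) : ℕ :=
  Nat.card {f : Fin n → Fin k //
    (∀ x, f (g x) = f x) ∧ ∀ i, ((Nat.card {x : Fin n // f x = i} : ℕ) : ℤ) = c i}

/-- The irreducible character `χ^μ` of `𝔖_n` associated to a partition `μ` of `n`
(encoded as a Young diagram with `n` cells), defined through the Jacobi–Trudi
determinantal formula `χ^μ = det (h_{μ_i - i + j})`. -/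
def chi (n : ℕ) (μ : YoungDiagram) (g : Equiv.Perm (Fin n)) : ℤ :=
  ∑ σ : Equiv.Perm (Fin μ.rowLens.length),
    ((Equiv.Perm.sign σ : ℤˣ) : ℤ) *
      (fixedYoungFns n μ.rowLens.length
        (fun i => ((μ.rowLen (i : ℕ) : ℕ) : ℤ) - ((i : ℕ) : ℤ) + ((σ i : ℕ) : ℤ)) g : ℤ)

/-! ### Posets, rank selection, maximal chains and characters -/

/-- The maximal chains of the subposet induced on a subset `A` of a poset. -/
def maxChainsIn {P : Type*} [Preorder P] (A : Set P) : Set (Set P) :=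
  {C | C ⊆ A ∧ IsChain (· ≤ ·) C ∧
    ∀ D : Set P, D ⊆ A → IsChain (· ≤ ·) D → C ⊆ D → C = D}

/-- The rank-selected subposet `P_S = {x ∈ P : rk x ∈ S} ∪ {⊥, ⊤}`. -/
def rankSel {P : Type*} [Preorder P] [OrderBot P] [OrderTop P] (rk : P → ℕ)
    (S : Finset ℕ) : Set P :=
  {x | rk x ∈ S} ∪ {⊥, ⊤}

/-- `a_P(S)`: the number of maximal chains of the rank-selected subposet `P_S`. -/
def chainCount {P : Type*} [Preorder P] [OrderBot P] [OrderTop P] (rk : P → ℕ)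
    (S : Finset ℕ) : ℕ :=
  Set.ncard (maxChainsIn (rankSel rk S))

/-- `b_P(S) = Σ_{T ⊆ S} (-1)^{|S-T|} a_P(T)`. -/
def bDim {P : Type*} [Preorder P] [OrderBot P] [OrderTop P] (rk : P → ℕ)
    (S : Finset ℕ) : ℤ :=
  ∑ T ∈ S.powerset, (-1 : ℤ) ^ (S.card - T.card) * (chainCount rk T : ℤ)

/-- The character of the permutation representation `α_P(S)` of a group `G` acting (via
`act`) on the maximal chains of the rank-selected subposet `P_S`: its value at `g` is
the number of maximal chains of `P_S` fixed by `g`. -/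
def gAlpha {P G : Type*} [Preorder P] [OrderBot P] [OrderTop P] (rk : P → ℕ)
    (act : G → P → P) (S : Finset ℕ) (g : G) : ℤ :=
  (Set.ncard {C : Set P | C ∈ maxChainsIn (rankSel rk S) ∧ act g '' C = C} : ℤ)

/-- The character of the virtual representation
`β_P(S) = Σ_{T ⊆ S} (-1)^{|S-T|} α_P(T)`. -/
def gBeta {P G : Type*} [Preorder P] [OrderBot P] [OrderTop P] (rk : P → ℕ)
    (act : G → P → P) (S : Finset ℕ) (g : G) : ℤ :=
  ∑ T ∈ S.powerset, (-1 : ℤ) ^ (S.card - T.card) * gAlpha rk act T g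

/-! ### The poset of injective words -/

/-- An injective word over the alphabet `{1,…,n}`. -/
def InjWord (n : ℕ) : Type := {l : List (Fin n) // l.Nodup}

instance (n : ℕ) : PartialOrder (InjWord n) where
  le u v := u.1.Sublist v.1
  le_refl u := List.Sublist.refl _
  le_trans u v w h1 h2 := List.Sublist.trans h1 h2
  le_antisymm u v h1 h2 := Subtype.ext (List.Sublist.antisymm h1 h2)

instance (n : ℕ) : OrderBot (InjWord n) where
  bot := ⟨[], List.nodup_nil⟩
  bot_le u := List.nil_sublist u.1

/-- The rank function of the poset of injective words (with a maximum adjoined):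
the rank of a word is its length, and the rank of `⊤` is `n+1`. -/
def rkInj (n : ℕ) (x : WithTop (InjWord n)) : ℕ :=
  WithTop.recTopCoe (n + 1) (fun u => u.1.length) x

/-- The action of `𝔖_n` on injective words, letter by letter. -/
def permWord {n : ℕ} (w : Equiv.Perm (Fin n)) (u : InjWord n) : InjWord n :=
  ⟨u.1.map w, u.2.map w.injective⟩

/-- The character of `α_{P_n}(S)` for the `𝔖_n`-action on the poset of injective words. -/
def injAlpha (n : ℕ) (S : Finset ℕ) (g : Equiv.Perm (Fin n)) : ℤ :=
  gAlpha (rkInj n) (fun w : Equiv.Perm (Fin n) => WithTop.map (permWord w)) S g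

/-- The character of `β_{P_n}(S)` for the `𝔖_n`-action on the poset of injective words. -/
def injBeta (n : ℕ) (S : Finset ℕ) (g : Equiv.Perm (Fin n)) : ℤ :=
  gBeta (rkInj n) (fun w : Equiv.Perm (Fin n) => WithTop.map (permWord w)) S g

/-! ### The poset of r-colored injective words -/

/-- An `r`-colored injective word over `{1,…,n}`: a word in the alphabet
`{1,…,n} × ℤ_r` whose letters have pairwise distinct first coordinates. -/
def CInjWord (n r : ℕ) : Type := {l : List (Fin n × ZMod r) // (l.map Prod.fst).Nodup}

instance (n r : ℕ) : PartialOrder (CInjWord n r) where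
  le u v := u.1.Sublist v.1
  le_refl u := List.Sublist.refl _
  le_trans u v w h1 h2 := List.Sublist.trans h1 h2
  le_antisymm u v h1 h2 := Subtype.ext (List.Sublist.antisymm h1 h2)

instance (n r : ℕ) : OrderBot (CInjWord n r) where
  bot := ⟨[], by simp⟩
  bot_le u := List.nil_sublist u.1

/-- The rank function of the poset `P_{n,r}` of `r`-colored injective words
(with a maximum adjoined). -/
def rkC (n r : ℕ) (x : WithTop (CInjWord n r)) : ℕ :=
  WithTop.recTopCoe (n + 1) (fun u => u.1.length) x

/-- The action of `𝔖_n` on `r`-colored injective words: act on the first coordinate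
of each letter, leaving colors unchanged. -/
def permCWord {n r : ℕ} (w : Equiv.Perm (Fin n)) (u : CInjWord n r) : CInjWord n r :=
  ⟨u.1.map (fun p => (w p.1, p.2)), by
    have h := u.2.map w.injective
    rw [List.map_map] at h ⊢
    exact h⟩

/-- The character of `α_{P_{n,r}}(S)`. -/
def cAlpha (n r : ℕ) (S : Finset ℕ) (g : Equiv.Perm (Fin n)) : ℤ :=
  gAlpha (rkC n r) (fun w : Equiv.Perm (Fin n) => WithTop.map (permCWord w)) S g

/-- The character of `β_{P_{n,r}}(S)`. -/
def cBeta (n r : ℕ) (S : Finset ℕ) (g : Equiv.Perm (Fin n)) : ℤ :=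
  gBeta (rkC n r) (fun w : Equiv.Perm (Fin n) => WithTop.map (permCWord w)) S g

/-- `b_{P_{n,r}}(S)`, the dimension of `β_{P_{n,r}}(S)`. -/
def cChainDim (n r : ℕ) (S : Finset ℕ) : ℤ := bDim (rkC n r) S

/-! ### The statistics τ -/

/-- `τ(w,Q)` for a permutation `w` with descent set `S = {s_1 < ⋯ < s_k}` and a standard
Young tableau `Q`: the largest `i ∈ {0,…,k+1}` such that (a) `w(x) = w_S(x)` for
`x > s_{k+1-i}` and (b) no descent of `Q` is smaller than `n - s_{k+1-i}`. -/
def tau (n : ℕ) (S : Finset ℕ) (wS w : Equiv.Perm (Fin n)) {μ : YoungDiagram}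
    (Q : SYT μ) : ℕ :=
  ((Finset.range (S.card + 2)).filter
    (fun i => (∀ x, sElt n S (S.card + 1 - i) < x → x ≤ n → permApp w x = permApp wS x) ∧
      (∀ d ∈ Q.des, n - sElt n S (S.card + 1 - i) ≤ d))).max'
    ⟨0, by
      have hs := sElt_of_gt n S (S.card + 1 - 0) (by omega)
      refine Finset.mem_filter.2 ⟨Finset.mem_range.2 (by omega), ?_, ?_⟩
      · intro x hx hx'
        rw [hs] at hx
        exact absurd hx (not_lt.2 hx')
      · intro d _
        rw [hs]
        omega⟩

/-- The condition that all the numbers `1,…,t` appear in the first row of the `r`-colored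
standard Young tableau `(Q, c)` and are colored with the zero color (the color of the
entry `k` being `c (k-1)`). -/
def zeroFirstRow {μ : YoungDiagram} {r : ℕ} (Q : SYT μ) (c : Fin μ.card → ZMod r)
    (t : ℕ) : Prop :=
  ∀ k : Fin μ.card, (k : ℕ) < t →
    ((∃ j, (0, j) ∈ μ ∧ Q.entry 0 j = (k : ℕ) + 1) ∧ c k = 0)

/-- `τ(w,Q)` for an `r`-colored standard Young tableau `(Q,c)`. -/
def ctau (n : ℕ) {r : ℕ} (S : Finset ℕ) (wS w : Equiv.Perm (Fin n)) {μ : YoungDiagram}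
    (Q : SYT μ) (c : Fin μ.card → ZMod r) : ℕ :=
  ((Finset.range (S.card + 2)).filter
    (fun i => (∀ x, sElt n S (S.card + 1 - i) < x → x ≤ n → permApp w x = permApp wS x) ∧
      zeroFirstRow Q c (n - sElt n S (S.card + 1 - i)))).max'
    ⟨0, by
      have hs := sElt_of_gt n S (S.card + 1 - 0) (by omega)
      refine Finset.mem_filter.2 ⟨Finset.mem_range.2 (by omega), ?_, ?_⟩
      · intro x hx hx'
        rw [hs] at hx
        exact absurd hx (not_lt.2 hx')
      · rw [hs]
        intro k hk
        exact absurd hk (by omega)⟩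

/-- The largest `i ∈ {0,…,n}` such that all the numbers `1,…,i` appear in the first row
of the `r`-colored standard Young tableau `(Q,c)` and are colored with the zero color. -/
def mQ (n : ℕ) {r : ℕ} {μ : YoungDiagram} (Q : SYT μ) (c : Fin μ.card → ZMod r) : ℕ :=
  ((Finset.range (n + 1)).filter (fun i => zeroFirstRow Q c i)).max'
    ⟨0, Finset.mem_filter.2 ⟨Finset.mem_range.2 (by omega),
      fun k hk => absurd hk (by omega)⟩⟩

/-- The condition, for an `r`-colored permutation `(π, c)` (the color of the entry
`π(x)` in one-line notation being `c (x-1)`), that the entries `π(1),…,π(t)` are in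
increasing order and all colored with the zero color. -/
def zeroIncreasing {n r : ℕ} (π : Equiv.Perm (Fin n)) (c : Fin n → ZMod r) (t : ℕ) : Prop :=
  (∀ x y, 1 ≤ x → x < y → y ≤ t → permApp π x < permApp π y) ∧
  ∀ k : Fin n, (k : ℕ) < t → c k = 0

/-- `τ(w,u)` for an `r`-colored permutation `u = (π, c)`. -/
def tauU (n : ℕ) {r : ℕ} (S : Finset ℕ) (wS w : Equiv.Perm (Fin n))
    (π : Equiv.Perm (Fin n)) (c : Fin n → ZMod r) : ℕ :=
  ((Finset.range (S.card + 2)).filter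
    (fun i => (∀ x, sElt n S (S.card + 1 - i) < x → x ≤ n → permApp w x = permApp wS x) ∧
      zeroIncreasing π c (n - sElt n S (S.card + 1 - i)))).max'
    ⟨0, by
      have hs := sElt_of_gt n S (S.card + 1 - 0) (by omega)
      refine Finset.mem_filter.2 ⟨Finset.mem_range.2 (by omega), ?_, ?_, ?_⟩
      · intro x hx hx'
        rw [hs] at hx
        exact absurd hx (not_lt.2 hx')
      · intro x y hx hxy hy
        rw [hs] at hy
        exact absurd hy (by omega)
      · rw [hs]
        intro k hk
        exact absurd hk (by omega)⟩

/-- The largest `i ∈ {0,…,n}` such that the entries `π(1),…,π(i)` of the `r`-colored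
permutation `(π,c)` are in increasing order and all colored with the zero color. -/
def mU (n : ℕ) {r : ℕ} (π : Equiv.Perm (Fin n)) (c : Fin n → ZMod r) : ℕ :=
  ((Finset.range (n + 1)).filter (fun i => zeroIncreasing π c i)).max'
    ⟨0, Finset.mem_filter.2 ⟨Finset.mem_range.2 (by omega),
      fun x y hx hxy hy => absurd hy (by omega),
      fun k hk => absurd hk (by omega)⟩⟩

/-- `a_m(T)`: the number of chains in the Boolean lattice `B_m` whose elements have
set of ranks (cardinalities) equal to `T`. -/
def boolChains (m : ℕ) (T : Finset ℕ) : ℕ :=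
  Nat.card {c : Finset (Finset (Fin m)) //
    IsChain (· ⊆ ·) (↑c : Set (Finset (Fin m))) ∧ c.image Finset.card = T}

end



theorem mem_descentSet' {n : ℕ} (w : Equiv.Perm (Fin n)) (i : ℕ) :
    i ∈ descentSet w ↔ ∃ (_ : 1 ≤ i) (h : i < n), w ⟨i, h⟩ < w ⟨i - 1, by omega⟩ := by
  unfold descentSet permApp
  rw [Finset.mem_filter, Finset.mem_Icc]
  constructor
  · rintro ⟨⟨h1, h2⟩, h3⟩
    have hn : i < n := by omega
    refine ⟨h1, hn, ?_⟩
    rw [dif_pos (by omega), dif_pos (by omega)] at h3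
    simp only [Nat.add_sub_cancel] at h3
    exact Fin.lt_def.2 (by omega)
  · rintro ⟨h1, hn, h3⟩
    refine ⟨⟨h1, by omega⟩, ?_⟩
    rw [dif_pos (by omega), dif_pos (by omega)]
    simp only [Nat.add_sub_cancel]
    rw [Fin.lt_def] at h3
    omega

/-- if no descent separates x and y, then w is increasing -/
theorem lt_of_not_sep {n : ℕ} (w : Equiv.Perm (Fin n)) (x y : ℕ) (hy : y < n) (hxy : x < y)
    (h : ∀ s ∈ descentSet w, x < s → ¬ s ≤ y) : w ⟨x, by omega⟩ < w ⟨y, hy⟩ := by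
  induction y with
  | zero => omega
  | succ y ih =>
    have h1 : w ⟨y, by omega⟩ < w ⟨y + 1, hy⟩ := by
      by_contra hc
      have hne : w ⟨y, by omega⟩ ≠ w ⟨y + 1, hy⟩ := by
        intro he
        have := w.injective he
        simp at this
      have : w ⟨y + 1, hy⟩ < w ⟨y, by omega⟩ := lt_of_le_of_ne (not_lt.1 hc) hne.symm
      refine h (y + 1) ?_ hxy le_rfl
      rw [mem_descentSet']
      exact ⟨by omega, hy, by simpa using this⟩
    rcases Nat.lt_or_ge x y with hxy' | hxy'
    · exact lt_trans (ih (by omega) hxy' (fun s hs h2 h3 => h s hs h2 (by omega))) h1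
    · have : x = y := by omega
      subst this
      exact h1

theorem exists_sep_perm (n : ℕ) (S : Finset ℕ) (hS : S ⊆ Finset.Icc 1 (n - 1)) :
    ∃ v : Equiv.Perm (Fin n), descentSet v = S ∧
      ∀ x y : Fin n, ∀ s ∈ S, (x : ℕ) < s → s ≤ (y : ℕ) → v y < v x := by
  let blk : ℕ → ℕ := fun x => (S.filter (· ≤ x)).card
  have hblk : ∀ x y, x ≤ y → blk x ≤ blk y := fun x y h =>
    Finset.card_le_card (fun s hs => by
      rw [Finset.mem_filter] at hs ⊢; exact ⟨hs.1, hs.2.trans h⟩)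
  have hblk2 : ∀ x y s, s ∈ S → x < s → s ≤ y → blk x < blk y := fun x y s hs h1 h2 => by
    apply Finset.card_lt_card
    rw [Finset.ssubset_iff_of_subset]
    · exact ⟨s, by simp [hs, h2], by simp [hs, h1]⟩
    · intro s hs
      rw [Finset.mem_filter] at hs ⊢; exact ⟨hs.1, by omega⟩
  let key : Fin n → ℤ ×ₗ ℤ := fun x => toLex (-(blk x : ℤ), (x : ℤ))
  have hinj : Function.Injective key := by
    intro x y h
    have := congrArg (fun z => (ofLex z).2) h
    simp only [key, ofLex_toLex] at this
    exact Fin.ext (by exact_mod_cast this)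
  let σ := Tuple.sort key
  have hm : StrictMono (key ∘ σ) :=
    (Tuple.monotone_sort key).strictMono_of_injective (hinj.comp σ.injective)
  have hv : ∀ x y, σ⁻¹ x < σ⁻¹ y ↔ key x < key y := by
    intro x y
    rw [← hm.lt_iff_lt]
    simp
  have hsep : ∀ x y : Fin n, ∀ s ∈ S, (x : ℕ) < s → s ≤ (y : ℕ) → σ⁻¹ y < σ⁻¹ x := by
    intro x y s hs h1 h2
    rw [hv, Prod.Lex.toLex_lt_toLex]
    left
    have := hblk2 x y s hs h1 h2
    simp only
    omega
  refine ⟨σ⁻¹, ?_, hsep⟩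
  ext i
  rw [mem_descentSet']
  constructor
  · rintro ⟨h1, h2, h3⟩
    by_contra hi
    rw [hv, Prod.Lex.toLex_lt_toLex] at h3
    have : blk i = blk (i - 1) := by
      apply congrArg Finset.card
      ext s
      simp only [Finset.mem_filter, and_congr_right_iff]
      intro hs
      have : s ≠ i := fun h => hi (h ▸ hs)
      omega
    simp only [this] at h3
    rcases h3 with h3 | h3
    · omega
    · have := h3.2
      omega
  · intro hi
    have := Finset.mem_Icc.1 (hS hi)
    exact ⟨this.1, by omega, hsep _ _ i hi (by simp; omega) (by simp)⟩

theorem wS_sep (n : ℕ) (S : Finset ℕ) (hS : S ⊆ Finset.Icc 1 (n - 1))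
    (wS : Equiv.Perm (Fin n)) (hwS : descentSet wS = S)
    (hwSmax : ∀ v : Equiv.Perm (Fin n), descentSet v = S → invCount v ≤ invCount wS) :
    ∀ x y : Fin n, ∀ s ∈ S, (x : ℕ) < s → s ≤ (y : ℕ) → wS y < wS x := by
  obtain ⟨v, hv, hsep⟩ := exists_sep_perm n S hS
  have h1 := hwSmax v hv
  unfold invCount at h1
  have h2 : (Finset.univ.filter fun p : Fin n × Fin n => p.1 < p.2 ∧ wS p.2 < wS p.1) ⊆
      (Finset.univ.filter fun p : Fin n × Fin n => p.1 < p.2 ∧ v p.2 < v p.1) := by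
    rintro ⟨x, y⟩ h
    simp only [Finset.mem_filter, Finset.mem_univ, true_and] at h ⊢
    refine ⟨h.1, ?_⟩
    by_contra hc
    refine absurd h.2 (not_lt.2 (le_of_lt ?_))
    apply lt_of_not_sep wS x y y.2 h.1
    intro s hs h3 h4
    rw [hwS] at hs
    exact hc (hsep x y s hs h3 h4)
  have h3 := Finset.eq_of_subset_of_card_le h2 h1
  intro x y s hs hx hy
  have : (x, y) ∈ (Finset.univ.filter fun p : Fin n × Fin n => p.1 < p.2 ∧ v p.2 < v p.1) := by
    simp only [Finset.mem_filter, Finset.mem_univ, true_and]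
    exact ⟨Fin.lt_def.2 (by omega), hsep x y s hs hx hy⟩
  rw [← h3] at this
  simp only [Finset.mem_filter, Finset.mem_univ, true_and] at this
  exact this.2


/-- number of flags of subsets of a `t`-set with ranks `T` -/
noncomputable def aNum (t : ℕ) (T : Finset ℕ) : ℕ :=
  if h : T.Nonempty then t.choose (T.max' h) * aNum (T.max' h) (T.erase (T.max' h)) else 1
termination_by T.card
decreasing_by exact Finset.card_erase_lt_of_mem (Finset.max'_mem _ _)

theorem aNum_empty (t : ℕ) : aNum t ∅ = 1 := by
  rw [aNum]; simp

theorem aNum_insert (t s : ℕ) (T : Finset ℕ) (h : ∀ x ∈ T, x < s) :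
    aNum t (insert s T) = t.choose s * aNum s T := by
  have hne : (insert s T).Nonempty := Finset.insert_nonempty _ _
  have hmax : (insert s T).max' hne = s := by
    apply le_antisymm
    · apply Finset.max'_le
      intro y hy
      rcases Finset.mem_insert.1 hy with rfl | hy
      · exact le_rfl
      · exact (h y hy).le
    · exact Finset.le_max' _ _ (Finset.mem_insert_self _ _)
  have hs : s ∉ T := fun hs => lt_irrefl _ (h s hs)
  rw [aNum, dif_pos hne, hmax, Finset.erase_insert hs]

/-- Lists with underlying set `X`, with no repetition, and descents in `T`. -/
def LD {n : ℕ} (X : Finset (Fin n)) (T : Finset ℕ) (l : List (Fin n)) : Prop :=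
  l.Nodup ∧ l.toFinset = X ∧ ∀ i (h : i + 1 < l.length), l[i + 1] < l[i] → i + 1 ∈ T

theorem LD.length {n : ℕ} {X : Finset (Fin n)} {T : Finset ℕ} {l : List (Fin n)} (h : LD X T l) :
    l.length = X.card := by
  rw [← h.2.1, List.toFinset_card_of_nodup h.1]

instance finite_LD {n : ℕ} (X : Finset (Fin n)) (T : Finset ℕ) : Finite {l // LD X T l} :=
  Finite.of_injective (β := {l : List (Fin n) // l.Nodup}) (fun l => ⟨l.1, l.2.1⟩) (by
    intro a b h
    simpa [Subtype.ext_iff] using h)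

theorem eq_sort_of_LD {n : ℕ} (X : Finset (Fin n)) (l : List (Fin n)) (hnd : l.Nodup)
    (hX : l.toFinset = X) (h : ∀ i (h : i + 1 < l.length), ¬ l[i + 1] < l[i]) :
    l = X.sort (· ≤ ·) := by
  subst hX
  symm
  apply List.Perm.eq_of_pairwise' (r := (· ≤ ·))
  · exact Finset.pairwise_sort _ _
  · rw [← List.isChain_iff_pairwise, List.isChain_iff_getElem]
    intro i hi
    exact not_lt.1 (h i hi)
  · exact (Finset.sort_perm_toList _ _).trans (List.toFinset_toList hnd)

theorem sort_no_desc {n : ℕ} (X : Finset (Fin n)) (i : ℕ) (h : i + 1 < (X.sort (· ≤ ·)).length) :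
    ¬ (X.sort (· ≤ ·))[i + 1] < (X.sort (· ≤ ·))[i] := by
  apply not_lt.2
  have := Finset.pairwise_sort X (· ≤ ·)
  rw [List.pairwise_iff_getElem] at this
  exact this i (i + 1) _ _ (by omega)

theorem LD_sort {n : ℕ} (X : Finset (Fin n)) (T : Finset ℕ) : LD X T (X.sort (· ≤ ·)) :=
  ⟨Finset.sort_nodup _ _, Finset.sort_toFinset _ _, fun i h h' => absurd h' (sort_no_desc X i h)⟩

theorem card_LD_insert {n : ℕ} (X : Finset (Fin n)) (T : Finset ℕ) (s : ℕ) (hs : s ≤ X.card)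
    (hT : ∀ x ∈ T, x < s) :
    Nat.card {l // LD X (insert s T) l} =
      ∑ A ∈ X.powersetCard s, Nat.card {l // LD A T l} := by
  have e : {l // LD X (insert s T) l} ≃ (Σ A : {A // A ∈ X.powersetCard s}, {l // LD A.1 T l}) :=
    { toFun := fun l => ⟨⟨(l.1.take s).toFinset, by
          rw [Finset.mem_powersetCard]
          constructor
          · intro x hx
            simp only [List.mem_toFinset] at hx
            have hx2 := List.mem_toFinset.2 (List.mem_of_mem_take hx)
            rwa [l.2.2.1] at hx2
          · rw [List.toFinset_card_of_nodup (l.2.1.sublist (List.take_sublist _ _)),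
              List.length_take, l.2.length]
            omega⟩,
          ⟨l.1.take s, l.2.1.sublist (List.take_sublist _ _), rfl, by
            intro i hi hd
            rw [List.length_take] at hi
            simp only [List.getElem_take] at hd
            have := l.2.2.2 i (by omega) hd
            rcases Finset.mem_insert.1 this with h | h
            · omega
            · exact h⟩⟩
      invFun := fun p => ⟨p.2.1 ++ (X \ p.1.1).sort (· ≤ ·), by
        obtain ⟨⟨A, hA⟩, ⟨l, hl⟩⟩ := p
        rw [Finset.mem_powersetCard] at hA
        refine ⟨?_, ?_, ?_⟩
        · rw [List.nodup_append']
          refine ⟨hl.1, Finset.sort_nodup _ _, ?_⟩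
          intro x hx hx'
          simp only [Finset.mem_sort, Finset.mem_sdiff] at hx'
          apply hx'.2
          have h3 := List.mem_toFinset.2 hx
          simp only at h3
          rwa [hl.2.1] at h3
        · rw [List.toFinset_append, hl.2.1, Finset.sort_toFinset]
          exact Finset.union_sdiff_of_subset hA.1
        · intro i hi hd
          simp only at hi hd
          have hlen := hl.length
          rw [hA.2] at hlen
          rcases lt_trichotomy (i + 1) s with h | h | h
          · rw [List.getElem_append_left (by omega), List.getElem_append_left (by omega)] at hd
            exact Finset.mem_insert_of_mem (hl.2.2 i (by omega) hd)
          · rw [h]; exact Finset.mem_insert_self _ _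
          · exfalso
            rw [List.length_append] at hi
            rw [List.getElem_append_right (by omega), List.getElem_append_right (by omega)] at hd
            have h2 := sort_no_desc (X \ A) (i - l.length) (by omega)
            apply h2
            convert hd using 2
            omega⟩
      left_inv := by
        rintro ⟨l, hl⟩
        apply Subtype.ext
        simp only
        conv_rhs => rw [← List.take_append_drop s l]
        congr 1
        symm
        apply eq_sort_of_LD
        · exact hl.1.sublist (List.drop_sublist _ _)
        · ext x
          have hnd := hl.1
          rw [← List.take_append_drop s l, List.nodup_append'] at hnd
          have hX := hl.2.1
          rw [← List.take_append_drop s l, List.toFinset_append] at hX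
          rw [← hX]
          simp only [List.mem_toFinset, Finset.mem_sdiff, Finset.mem_union]
          constructor
          · intro hx
            exact ⟨Or.inr hx, fun h' => hnd.2.2 h' hx⟩
          · rintro ⟨h1 | h1, h2⟩
            · exact absurd h1 h2
            · exact h1
        · intro i hi hd
          rw [List.length_drop] at hi
          simp only [List.getElem_drop] at hd
          have := hl.2.2 (s + i) (by omega) hd
          rcases Finset.mem_insert.1 this with h | h
          · omega
          · have := hT _ h
            omega
      right_inv := by
        rintro ⟨⟨A, hA⟩, ⟨l, hl⟩⟩
        have hA' := hA
        rw [Finset.mem_powersetCard] at hA'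
        have hlen : l.length = s := by rw [hl.length, hA'.2]
        have ht : (l ++ (X \ A).sort (· ≤ ·)).take s = l := by
          rw [List.take_append_of_le_length (by omega), List.take_of_length_le (by omega)]
        have hAt : ((l ++ (X \ A).sort (· ≤ ·)).take s).toFinset = A := by rw [ht, hl.2.1]
        simp only
        apply Sigma.ext
        · exact Subtype.ext hAt
        · simp only
          rw [Subtype.heq_iff_coe_eq]
          · exact ht
          · intro x
            rw [hAt] }
  rw [Nat.card_congr e, Nat.card_sigma]
  exact Finset.sum_coe_sort (X.powersetCard s) (fun A => Nat.card {l // LD A T l})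

theorem card_LD {n : ℕ} (T : Finset ℕ) : ∀ (X : Finset (Fin n)), (∀ s ∈ T, s ≤ X.card) →
    Nat.card {l // LD X T l} = aNum X.card T := by
  induction T using Finset.induction_on_max with
  | empty =>
    intro X _
    rw [aNum_empty, Nat.card_eq_one_iff_unique]
    refine ⟨⟨?_⟩, ⟨⟨_, LD_sort X _⟩⟩⟩
    have : ∀ l : {l // LD X ∅ l}, l.1 = X.sort (· ≤ ·) := fun l =>
      eq_sort_of_LD X l.1 l.2.1 l.2.2.1 (fun i hi hd => by
        have := l.2.2.2 i hi hd
        simp at this)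
    intro a b
    exact Subtype.ext ((this a).trans (this b).symm)
  | insert s T hs ih =>
    intro X hX
    rw [card_LD_insert X T s (hX s (Finset.mem_insert_self _ _)) hs, aNum_insert _ _ _ hs]
    have : ∀ A ∈ X.powersetCard s, Nat.card {l // LD A T l} = aNum s T := by
      intro A hA
      rw [Finset.mem_powersetCard] at hA
      rw [ih A (fun x hx => by rw [hA.2]; exact (hs x hx).le), hA.2]
    rw [Finset.sum_congr rfl this, Finset.sum_const, Finset.card_powersetCard, smul_eq_mul]


theorem card_perm_desc_sub {n : ℕ} (w0 : Equiv.Perm (Fin n)) (s : ℕ) (hs : s ≤ n) (T : Finset ℕ)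
    (hT : ∀ x ∈ T, x ≤ s) :
    Nat.card {w : Equiv.Perm (Fin n) // (∀ x : Fin n, s ≤ (x : ℕ) → w x = w0 x) ∧
      (descentSet w).filter (· < s) ⊆ T} = aNum s T := by
  set X : Finset (Fin n) := (Finset.univ.filter (fun x : Fin n => (x : ℕ) < s)).image w0 with hXdef
  have hXc : X.card = s := by
    rw [hXdef, Finset.card_image_of_injective _ w0.injective]
    rw [Fin.card_filter_val_lt]
    omega
  have key := card_LD T X (by rw [hXc]; exact hT)
  rw [hXc] at key
  rw [← key]
  have hlen : ∀ w : Equiv.Perm (Fin n), ((List.ofFn w).take s).length = s := by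
    intro w; simp [hs]
  have hsame : ∀ w : Equiv.Perm (Fin n), (∀ x : Fin n, s ≤ (x : ℕ) → w x = w0 x) →
      ∀ x : Fin n, (x : ℕ) < s → ((w0.symm (w x) : Fin n) : ℕ) < s := by
    intro w hw x hx
    by_contra hc
    have h1 := hw (w0.symm (w x)) (by omega)
    rw [Equiv.apply_symm_apply] at h1
    have h2 := w.injective h1
    rw [h2] at hc
    exact hc hx
  have hmem : ∀ w : Equiv.Perm (Fin n), (∀ x : Fin n, s ≤ (x : ℕ) → w x = w0 x) →
      ((List.ofFn w).take s).toFinset ⊆ X := by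
    intro w hw y hy
    simp only [List.mem_toFinset] at hy
    obtain ⟨i, hi, rfl⟩ := List.mem_iff_getElem.1 hy
    rw [hlen] at hi
    simp only [List.getElem_take, List.getElem_ofFn, hXdef, Finset.mem_image, Finset.mem_filter,
      Finset.mem_univ, true_and]
    exact ⟨w0.symm (w ⟨i, by omega⟩), hsame w hw ⟨i, by omega⟩ hi, by simp⟩
  have hnd : ∀ w : Equiv.Perm (Fin n), ((List.ofFn w).take s).Nodup := fun w =>
    (List.nodup_ofFn.2 w.injective).sublist (List.take_sublist _ _)
  apply Nat.card_eq_of_bijective (fun w => ⟨(List.ofFn w.1).take s, hnd w.1, by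
      apply Finset.eq_of_subset_of_card_le (hmem w.1 w.2.1)
      rw [hXc, List.toFinset_card_of_nodup (hnd w.1), hlen], by
      intro i hi hd
      rw [hlen] at hi
      simp only [List.getElem_take, List.getElem_ofFn] at hd
      apply w.2.2
      rw [Finset.mem_filter, mem_descentSet']
      exact ⟨⟨by omega, by omega, hd⟩, hi⟩⟩)
  constructor
  · rintro ⟨w, hw⟩ ⟨w', hw'⟩ h
    apply Subtype.ext
    have h := congrArg Subtype.val h
    simp only at h
    ext x
    congr 1
    rcases Nat.lt_or_ge x s with hx | hx
    · have h2 : ((List.ofFn w).take s)[(x : ℕ)]'(by rw [hlen]; exact hx) =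
        ((List.ofFn w').take s)[(x : ℕ)]'(by rw [hlen]; exact hx) := by
          congr 1
      simpa using h2
    · rw [hw.1 x hx, hw'.1 x hx]
  · rintro ⟨l, hl⟩
    have hll : l.length = s := by rw [hl.length, hXc]
    have hlX : ∀ i (h : i < l.length), l[i] ∈ X := by
      intro i h
      have : l[i] ∈ l.toFinset := by simp
      rwa [hl.2.1] at this
    let f : Fin n → Fin n := fun x => if h : (x : ℕ) < s then l[(x : ℕ)] else w0 x
    have hf : Function.Injective f := by
      intro x y hxy
      simp only [f] at hxy
      have hcr : ∀ (a : ℕ) (ha : a < l.length) (y : Fin n), ¬ (y : ℕ) < s → l[a] ≠ w0 y := by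
        intro a ha y hy h
        have h2 := hlX a ha
        rw [h, hXdef, Finset.mem_image] at h2
        obtain ⟨z, hz, hzy⟩ := h2
        rw [w0.injective hzy] at hz
        simp only [Finset.mem_filter] at hz
        exact hy hz.2
      split_ifs at hxy with h1 h2 h2
      · have := (List.Nodup.getElem_inj_iff hl.1).1 hxy
        exact Fin.ext this
      · exact absurd hxy (hcr _ _ _ h2)
      · exact absurd hxy.symm (hcr _ _ _ h1)
      · exact w0.injective hxy
    let w : Equiv.Perm (Fin n) := Equiv.ofBijective f (Finite.injective_iff_bijective.1 hf)
    have hwf : ∀ x, w x = f x := fun x => rfl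
    refine ⟨⟨w, ?_, ?_⟩, ?_⟩
    · intro x hx
      rw [hwf]
      simp only [f]
      rw [dif_neg (by omega)]
    · intro i hi
      rw [Finset.mem_filter, mem_descentSet'] at hi
      obtain ⟨⟨h1, h2, h3⟩, h4⟩ := hi
      rw [hwf, hwf] at h3
      simp only [f] at h3
      rw [dif_pos h4, dif_pos (by omega)] at h3
      have := hl.2.2 (i - 1) (by omega) (by
        convert h3 using 2
        omega)
      rwa [Nat.sub_add_cancel h1] at this
    · apply Subtype.ext
      apply List.ext_getElem
      · rw [hlen, hll]
      · intro i h1 h2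
        rw [hll] at h2
        simp only [List.getElem_take, List.getElem_ofFn]
        rw [hwf]
        simp only [f]
        rw [dif_pos h2]

theorem moebius_card {α : Type*} [Fintype α] (D : α → Finset ℕ) (U : Finset ℕ) :
    ∑ T ∈ U.powerset, (-1 : ℤ) ^ (U.card - T.card) * (Nat.card {w : α // D w ⊆ T} : ℤ) =
      (Nat.card {w : α // D w = U} : ℤ) := by
  have h1 : ∀ T, (Nat.card {w : α // D w ⊆ T} : ℤ) = ∑ w : α, if D w ⊆ T then 1 else 0 := by
    intro T
    rw [Nat.card_eq_fintype_card, Fintype.card_subtype, Finset.card_filter]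
    push_cast
    rfl
  have h2 : (Nat.card {w : α // D w = U} : ℤ) = ∑ w : α, if D w = U then 1 else 0 := by
    rw [Nat.card_eq_fintype_card, Fintype.card_subtype, Finset.card_filter]
    push_cast
    rfl
  rw [h2]
  simp_rw [h1, Finset.mul_sum]
  rw [Finset.sum_comm]
  apply Finset.sum_congr rfl
  intro w _
  by_cases hU : D w ⊆ U
  · have h3 : ∑ T ∈ U.powerset, (-1 : ℤ) ^ (U.card - T.card) * (if D w ⊆ T then 1 else 0) =
        ∑ T ∈ (U \ D w).powerset, (-1 : ℤ) ^ T.card := by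
      simp_rw [mul_ite, mul_one, mul_zero]
      rw [← Finset.sum_filter]
      refine Finset.sum_bij' (fun T _ => U \ T) (fun T _ => U \ T) ?_ ?_ ?_ ?_ ?_
      · intro T hT
        simp only [Finset.mem_filter, Finset.mem_powerset] at hT ⊢
        exact Finset.sdiff_subset_sdiff le_rfl hT.2
      · intro T hT
        simp only [Finset.mem_filter, Finset.mem_powerset] at hT ⊢
        refine ⟨Finset.sdiff_subset, ?_⟩
        intro x hx
        simp only [Finset.mem_sdiff]
        refine ⟨hU hx, fun hxT => ?_⟩
        have := hT hxT
        simp only [Finset.mem_sdiff] at this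
        exact this.2 hx
      · intro T hT
        simp only [Finset.mem_filter, Finset.mem_powerset] at hT
        exact Finset.sdiff_sdiff_eq_self hT.1
      · intro T hT
        simp only [Finset.mem_powerset] at hT
        exact Finset.sdiff_sdiff_eq_self (hT.trans Finset.sdiff_subset)
      · intro T hT
        simp only [Finset.mem_filter, Finset.mem_powerset] at hT
        rw [Finset.card_sdiff_of_subset hT.1]
    rw [h3, Finset.sum_powerset_neg_one_pow_card]
    have : U \ D w = ∅ ↔ D w = U := by
      rw [Finset.sdiff_eq_empty_iff_subset]
      exact ⟨fun h => Finset.Subset.antisymm hU h, fun h => h.ge⟩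
    simp only [this]
  · have hne : ¬ D w = U := fun h => hU h.le
    rw [if_neg hne]
    apply Finset.sum_eq_zero
    intro T hT
    rw [if_neg, mul_zero]
    intro h
    exact hU (h.trans (Finset.mem_powerset.1 hT))

theorem sum_aNum {n : ℕ} (w0 : Equiv.Perm (Fin n)) (s : ℕ) (hs : s ≤ n) (U : Finset ℕ)
    (hU : ∀ x ∈ U, x ≤ s) :
    ∑ T ∈ U.powerset, (-1 : ℤ) ^ (U.card - T.card) * (aNum s T : ℤ) =
    (Nat.card {w : Equiv.Perm (Fin n) // (∀ x : Fin n, s ≤ (x : ℕ) → w x = w0 x) ∧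
      (descentSet w).filter (· < s) = U} : ℤ) := by
  have e : ∀ p : Finset ℕ → Prop,
      Nat.card {w : Equiv.Perm (Fin n) // (∀ x : Fin n, s ≤ (x : ℕ) → w x = w0 x) ∧
        p ((descentSet w).filter (· < s))} =
      Nat.card {w : {w : Equiv.Perm (Fin n) // ∀ x : Fin n, s ≤ (x : ℕ) → w x = w0 x} //
        p ((descentSet w.1).filter (· < s))} := by
    intro p
    exact (Nat.card_congr (Equiv.subtypeSubtypeEquivSubtypeInter _
      (fun w : Equiv.Perm (Fin n) => p ((descentSet w).filter (· < s))))).symm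
  rw [e (fun D => D = U), ← moebius_card (α := {w : Equiv.Perm (Fin n) //
    ∀ x : Fin n, s ≤ (x : ℕ) → w x = w0 x}) (fun w => (descentSet w.1).filter (· < s)) U]
  apply Finset.sum_congr rfl
  intro T hT
  rw [← card_perm_desc_sub w0 s hs T (fun x hx => hU x (Finset.mem_powerset.1 hT hx)),
    e (fun D => D ⊆ T)]


/-- length of an injective word -/
def wlen {n : ℕ} (u : InjWord n) : ℕ := u.1.length

instance finite_InjWord (n : ℕ) : Finite (InjWord n) :=
  inferInstanceAs (Finite {l : List (Fin n) // l.Nodup})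

theorem InjWord.le_def {n : ℕ} (u v : InjWord n) : u ≤ v ↔ u.1.Sublist v.1 := Iff.rfl

theorem wlen_mono {n : ℕ} {u v : InjWord n} (h : u ≤ v) : wlen u ≤ wlen v :=
  List.Sublist.length_le h

theorem eq_of_le_of_wlen {n : ℕ} {u v : InjWord n} (h : u ≤ v) (h2 : wlen v ≤ wlen u) : u = v :=
  Subtype.ext (List.Sublist.eq_of_length_le h h2)

/-- `D` is a chain of words with set of ranks `T` inside `K` -/
def IsCh {n : ℕ} (T : Finset ℕ) (K : Set (InjWord n)) (D : Finset (InjWord n)) : Prop :=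
  IsChain (· ≤ ·) (D : Set (InjWord n)) ∧ D.image wlen = T ∧ ∀ u ∈ D, u ∈ K

theorem card_IsCh_empty {n : ℕ} (K : Set (InjWord n)) : Nat.card {D // IsCh ∅ K D} = 1 := by
  rw [Nat.card_eq_one_iff_unique]
  refine ⟨⟨?_⟩, ⟨⟨∅, by simp [IsCh]⟩⟩⟩
  rintro ⟨a, ha⟩ ⟨b, hb⟩
  have h1 := ha.2.1
  have h2 := hb.2.1
  rw [Finset.image_eq_empty] at h1 h2
  simp [h1, h2]

theorem card_IsCh_insert {n : ℕ} (t : ℕ) (T : Finset ℕ) (K : Set (InjWord n)) (hK : IsLowerSet K)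
    (hT : ∀ x ∈ T, x < t) :
    Nat.card {D // IsCh (insert t T) K D} =
      Nat.card (Σ v : {v : InjWord n // v ∈ K ∧ wlen v = t}, {D // IsCh T (Set.Iic v.1) D}) := by
  have htT : t ∉ T := fun h => lt_irrefl _ (hT t h)
  symm
  have hlt : ∀ (K' : Set (InjWord n)) (D : Finset (InjWord n)), IsCh T K' D → ∀ u ∈ D, wlen u < t :=
    fun K' D hD u hu => hT _ (hD.2.1 ▸ Finset.mem_image_of_mem _ hu)
  apply Nat.card_eq_of_bijective (fun p => ⟨insert p.1.1 p.2.1, by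
    obtain ⟨⟨v, hvK, hvt⟩, ⟨D, hD⟩⟩ := p
    refine ⟨?_, ?_, ?_⟩
    · simp only [Finset.coe_insert]
      apply IsChain.insert hD.1
      intro u hu _
      exact Or.inr (hD.2.2 u hu)
    · simp only
      rw [Finset.image_insert, hD.2.1, hvt]
    · intro u hu
      rcases Finset.mem_insert.1 hu with rfl | hu
      · exact hvK
      · exact hK (hD.2.2 u hu) hvK⟩)
  constructor
  · rintro ⟨⟨v, hvK, hvt⟩, ⟨D, hD⟩⟩ ⟨⟨v', hvK', hvt'⟩, ⟨D', hD'⟩⟩ h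
    have h := congrArg Subtype.val h
    simp only at h
    have hv : v = v' := by
      have : v ∈ insert v' D' := h ▸ Finset.mem_insert_self _ _
      rcases Finset.mem_insert.1 this with h1 | h1
      · exact h1
      · have := hlt _ _ hD' _ h1
        omega
    subst hv
    have hDD : D = D' := by
      have h1 : v ∉ D := fun h1 => by have := hlt _ _ hD _ h1; omega
      have h2 : v ∉ D' := fun h1 => by have := hlt _ _ hD' _ h1; omega
      rw [← Finset.erase_insert h1, h, Finset.erase_insert h2]
    subst hDD
    rfl
  · rintro ⟨D, hD⟩
    have : t ∈ D.image wlen := hD.2.1 ▸ Finset.mem_insert_self _ _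
    obtain ⟨v, hv, hvt⟩ := Finset.mem_image.1 this
    have hlen : ∀ u ∈ D, wlen u = t → u = v := by
      intro u hu hut
      rcases hD.1.total hu hv with h | h
      · exact eq_of_le_of_wlen h (by omega)
      · exact (eq_of_le_of_wlen h (by omega)).symm
    have hins : ∀ u ∈ D, wlen u = t ∨ wlen u ∈ T := by
      intro u hu
      have := Finset.mem_image_of_mem wlen hu
      rw [hD.2.1] at this
      exact Finset.mem_insert.1 this
    refine ⟨⟨⟨v, hD.2.2 v hv, hvt⟩, ⟨D.erase v, ?_, ?_, ?_⟩⟩, ?_⟩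
    · exact hD.1.mono (by simp)
    · ext x
      rw [Finset.mem_image]
      constructor
      · rintro ⟨u, hu, rfl⟩
        rw [Finset.mem_erase] at hu
        rcases hins u hu.2 with h | h
        · exact absurd (hlen u hu.2 h) hu.1
        · exact h
      · intro hx
        have : x ∈ D.image wlen := hD.2.1 ▸ Finset.mem_insert_of_mem hx
        obtain ⟨u, hu, rfl⟩ := Finset.mem_image.1 this
        refine ⟨u, Finset.mem_erase.2 ⟨?_, hu⟩, rfl⟩
        rintro rfl
        exact htT (hvt ▸ hx)
    · intro u hu
      rw [Finset.mem_erase] at hu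
      rcases hD.1.total hu.2 hv with h | h
      · exact h
      · exfalso
        have h1 := wlen_mono h
        rcases hins u hu.2 with h2 | h2
        · exact hu.1 (hlen u hu.2 h2)
        · have := hT _ h2
          omega
    · apply Subtype.ext
      simp only
      exact Finset.insert_erase hv

theorem card_le_wlen {n : ℕ} (v : InjWord n) (s : ℕ) :
    Nat.card {u : InjWord n // u ∈ Set.Iic v ∧ wlen u = s} = (wlen v).choose s := by
  have h : Nat.card {u : InjWord n // u ∈ Set.Iic v ∧ wlen u = s} =
      Nat.card {l // l ∈ (v.1.sublistsLen s).toFinset} := by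
    refine Nat.card_congr
      { toFun := fun u => ⟨u.1.1, by
          rw [List.mem_toFinset, List.mem_sublistsLen]
          exact ⟨u.2.1, u.2.2⟩⟩
        invFun := fun l => ⟨⟨l.1, by
          have := l.2
          rw [List.mem_toFinset, List.mem_sublistsLen] at this
          exact v.2.sublist this.1⟩, by
          have := l.2
          rw [List.mem_toFinset, List.mem_sublistsLen] at this
          exact this⟩
        left_inv := fun u => rfl
        right_inv := fun l => rfl }
  rw [h, Nat.card_eq_fintype_card, Fintype.card_coe,
    List.toFinset_card_of_nodup (List.nodup_sublistsLen _ v.2), List.length_sublistsLen]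
  rfl

theorem card_IsCh_Iic {n : ℕ} (T : Finset ℕ) :
    ∀ v : InjWord n, Nat.card {D // IsCh T (Set.Iic v) D} = aNum (wlen v) T := by
  induction T using Finset.induction_on_max with
  | empty => intro v; rw [card_IsCh_empty, aNum_empty]
  | insert s T hs ih =>
    intro v
    rw [card_IsCh_insert s T _ (isLowerSet_Iic v) hs, aNum_insert _ _ _ hs]
    have := Fintype.ofFinite {u : InjWord n // u ∈ Set.Iic v ∧ wlen u = s}
    rw [Nat.card_sigma, ← card_le_wlen v s, Nat.card_eq_fintype_card (α := {u : InjWord n // u ∈ Set.Iic v ∧ wlen u = s})]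
    rw [Finset.sum_congr rfl (fun u _ => by rw [ih u.1, u.2.2])]
    simp

theorem permWord_eq_iff {n : ℕ} (g : Equiv.Perm (Fin n)) (u : InjWord n) :
    permWord g u = u ↔ ∀ x ∈ u.1, g x = x := by
  have h0 : permWord g u = u ↔ u.1.map g = u.1 :=
    ⟨fun h => congrArg Subtype.val h, fun h => Subtype.ext h⟩
  rw [h0]
  conv_lhs => rhs; rw [← List.map_id u.1]
  rw [List.map_inj_left]
  simp

/-- number of words of length `t` fixed by `g` -/
noncomputable def fixW (n t : ℕ) (g : Equiv.Perm (Fin n)) : ℕ :=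
  Nat.card {v : InjWord n // v ∈ {u | permWord g u = u} ∧ wlen v = t}

theorem isLowerSet_fix {n : ℕ} (g : Equiv.Perm (Fin n)) :
    IsLowerSet {u : InjWord n | permWord g u = u} := by
  intro u v huv hu
  simp only [Set.mem_ofPred_eq, permWord_eq_iff] at hu ⊢
  exact fun x hx => hu x (List.Sublist.subset huv hx)

theorem card_IsCh_fix {n : ℕ} (g : Equiv.Perm (Fin n)) (t : ℕ) (T : Finset ℕ)
    (hT : ∀ x ∈ T, x < t) :
    Nat.card {D // IsCh (insert t T) {u | permWord g u = u} D} = fixW n t g * aNum t T := by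
  rw [card_IsCh_insert t T _ (isLowerSet_fix g) hT]
  have := Fintype.ofFinite {v : InjWord n // v ∈ {u | permWord g u = u} ∧ wlen v = t}
  rw [Nat.card_sigma, fixW, Nat.card_eq_fintype_card (α := {v : InjWord n // v ∈ {u | permWord g u = u} ∧ wlen v = t})]
  rw [Finset.sum_congr rfl (fun u _ => by rw [card_IsCh_Iic, u.2.2])]
  simp


theorem exists_between_sublist {α : Type*} (u v : List α) (h : u.Sublist v) (t : ℕ)
    (h1 : u.length ≤ t) (h2 : t ≤ v.length) : ∃ x : List α, u.Sublist x ∧ x.Sublist v ∧ x.length = t := by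
  induction h generalizing t with
  | slnil => exact ⟨[], by simp, by simp, by simp at h2; simp [h2]⟩
  | @cons l1 l2 a h ih =>
    rcases Nat.lt_or_ge l2.length t with h3 | h3
    · simp only [List.length_cons] at h2
      exact ⟨a :: l2, h.cons a, List.Sublist.refl _, by simp; omega⟩
    · obtain ⟨x, hx1, hx2, hx3⟩ := ih t h1 h3
      exact ⟨x, hx1, hx2.cons a, hx3⟩
  | @cons_cons l1 l2 a h ih =>
    simp only [List.length_cons] at h1 h2
    obtain ⟨x, hx1, hx2, hx3⟩ := ih (t - 1) (by omega) (by omega)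
    exact ⟨a :: x, hx1.cons_cons a, hx2.cons_cons a, by simp; omega⟩

theorem exists_full {n : ℕ} (u : InjWord n) : ∃ v : InjWord n, u ≤ v ∧ wlen v = n := by
  have hnd : (u.1 ++ (Finset.univ \ u.1.toFinset).toList).Nodup := by
    rw [List.nodup_append']
    refine ⟨u.2, Finset.nodup_toList _, ?_⟩
    intro x hx hx'
    simp only [Finset.mem_toList, Finset.mem_sdiff, List.mem_toFinset] at hx'
    exact hx'.2 hx
  refine ⟨⟨_, hnd⟩, List.sublist_append_left _ _, ?_⟩
  unfold wlen
  rw [← List.toFinset_card_of_nodup hnd, List.toFinset_append, Finset.toList_toFinset,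
    Finset.union_sdiff_of_subset (Finset.subset_univ _)]
  simp

theorem rkInj_coe {n : ℕ} (u : InjWord n) : rkInj n (u : WithTop (InjWord n)) = wlen u := rfl
theorem rkInj_top {n : ℕ} : rkInj n (⊤ : WithTop (InjWord n)) = n + 1 := rfl
theorem coe_bot' {n : ℕ} : ((⊥ : InjWord n) : WithTop (InjWord n)) = ⊥ := rfl
theorem wlen_bot {n : ℕ} : wlen (⊥ : InjWord n) = 0 := rfl

/-- the set chain attached to a finset chain -/
def toC {n : ℕ} (D : Finset (InjWord n)) : Set (WithTop (InjWord n)) :=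
  {⊥, ⊤} ∪ ((↑) : InjWord n → WithTop (InjWord n)) '' (D : Set (InjWord n))

theorem coe_mem_toC {n : ℕ} (D : Finset (InjWord n)) (u : InjWord n) :
    (u : WithTop (InjWord n)) ∈ toC D ↔ u = ⊥ ∨ u ∈ D := by
  unfold toC
  rw [← coe_bot']
  simp

theorem toC_isChain {n : ℕ} (D : Finset (InjWord n))
    (hD : IsChain (· ≤ ·) (D : Set (InjWord n))) : IsChain (· ≤ ·) (toC D) := by
  rintro x hx y hy hxy
  induction x with
  | top => exact Or.inr le_top
  | coe x =>
    induction y with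
    | top => exact Or.inl le_top
    | coe y =>
      rw [coe_mem_toC] at hx hy
      rcases hx with rfl | hx
      · exact Or.inl (by rw [coe_bot']; exact bot_le)
      · rcases hy with rfl | hy
        · exact Or.inr (by rw [coe_bot']; exact bot_le)
        · rcases hD.total hx hy with h | h
          · exact Or.inl (WithTop.coe_le_coe.2 h)
          · exact Or.inr (WithTop.coe_le_coe.2 h)

theorem toC_maximal {n : ℕ} (T : Finset ℕ) (hT : T ⊆ Finset.Icc 1 n) (D : Finset (InjWord n))
    (hD : IsChain (· ≤ ·) (D : Set (InjWord n))) (hD2 : D.image wlen = T) :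
    toC D ∈ maxChainsIn (rankSel (rkInj n) T) := by
  refine ⟨?_, toC_isChain D hD, ?_⟩
  · intro x hx
    induction x with
    | top => right; simp
    | coe x =>
      rw [coe_mem_toC] at hx
      rcases hx with rfl | hx
      · right; simp [coe_bot']
      · left
        change rkInj n x ∈ T
        rw [rkInj_coe, ← hD2]
        exact Finset.mem_image_of_mem _ hx
  · intro E hE hEc hDE
    apply Set.Subset.antisymm hDE
    intro x hx
    induction x with
    | top => unfold toC; simp
    | coe x =>
      rw [coe_mem_toC]
      rcases hE hx with h | h
      · right
        change rkInj n x ∈ T at h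
        rw [rkInj_coe, ← hD2, Finset.mem_image] at h
        obtain ⟨y, hy, hyx⟩ := h
        have hyE : (y : WithTop (InjWord n)) ∈ E := hDE ((coe_mem_toC _ _).2 (Or.inr hy))
        have : x = y := by
          rcases hEc.total hx hyE with h | h
          · exact eq_of_le_of_wlen (WithTop.coe_le_coe.1 h) (by omega)
          · exact (eq_of_le_of_wlen (WithTop.coe_le_coe.1 h) (by omega)).symm
        rw [this]; exact hy
      · left
        simp only [Set.mem_insert_iff, Set.mem_singleton_iff, WithTop.coe_ne_top, or_false] at h
        rw [← coe_bot'] at h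
        exact WithTop.coe_injective h

theorem exists_of_maximal {n : ℕ} (T : Finset ℕ) (hT : T ⊆ Finset.Icc 1 n)
    (C : Set (WithTop (InjWord n))) (hC : C ∈ maxChainsIn (rankSel (rkInj n) T)) :
    ∃ D : Finset (InjWord n), IsChain (· ≤ ·) (D : Set (InjWord n)) ∧ D.image wlen = T ∧
      toC D = C := by
  obtain ⟨hCA, hCc, hCm⟩ := hC
  have hins : ∀ x ∈ rankSel (rkInj n) T, (∀ y ∈ C, x ≤ y ∨ y ≤ x) → x ∈ C := by
    intro x hx hxy
    have := hCm (insert x C) (Set.insert_subset hx hCA)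
      (hCc.insert (fun y hy _ => hxy y hy)) (Set.subset_insert _ _)
    rw [this]
    exact Set.mem_insert _ _
  have hbot : (⊥ : WithTop (InjWord n)) ∈ C :=
    hins _ (Or.inr (by simp)) (fun y _ => Or.inl bot_le)
  have htop : (⊤ : WithTop (InjWord n)) ∈ C :=
    hins _ (Or.inr (by simp)) (fun y _ => Or.inr le_top)
  have hfin := Fintype.ofFinite (InjWord n)
  let D : Finset (InjWord n) := Finset.univ.filter
    (fun u => (u : WithTop (InjWord n)) ∈ C ∧ wlen u ∈ T)
  have hmemD : ∀ u, u ∈ D ↔ (u : WithTop (InjWord n)) ∈ C ∧ wlen u ∈ T := by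
    intro u; simp [D]
  refine ⟨D, ?_, ?_, ?_⟩
  · intro u hu v hv _
    have hu := (hmemD u).1 hu
    have hv := (hmemD v).1 hv
    rcases hCc.total hu.1 hv.1 with h | h
    · exact Or.inl (WithTop.coe_le_coe.1 h)
    · exact Or.inr (WithTop.coe_le_coe.1 h)
  · apply Finset.Subset.antisymm
    · intro x hx
      obtain ⟨u, hu, rfl⟩ := Finset.mem_image.1 hx
      exact ((hmemD u).1 hu).2
    · intro t ht
      have htn := Finset.mem_Icc.1 (hT ht)
      -- largest element of C below rank t
      let Lo : Finset (InjWord n) := Finset.univ.filter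
        (fun u => (u : WithTop (InjWord n)) ∈ C ∧ wlen u ≤ t)
      let Up : Finset (InjWord n) := Finset.univ.filter
        (fun u => (u : WithTop (InjWord n)) ∈ C ∧ t ≤ wlen u)
      have hLo : Lo.Nonempty := ⟨⊥, by simp [Lo, coe_bot', hbot, wlen_bot]⟩
      obtain ⟨u, hu, humax⟩ := Finset.exists_max_image Lo wlen hLo
      simp only [Lo, Finset.mem_filter, Finset.mem_univ, true_and] at hu humax
      have hv : ∃ v : InjWord n, u ≤ v ∧ t ≤ wlen v ∧
          ∀ y : InjWord n, (y : WithTop (InjWord n)) ∈ C → t ≤ wlen y → v ≤ y := by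
        by_cases hUp : Up.Nonempty
        · obtain ⟨v, hv, hvmin⟩ := Finset.exists_min_image Up wlen hUp
          simp only [Up, Finset.mem_filter, Finset.mem_univ, true_and] at hv hvmin
          refine ⟨v, ?_, hv.2, ?_⟩
          · rcases hCc.total hu.1 hv.1 with h | h
            · exact WithTop.coe_le_coe.1 h
            · rw [eq_of_le_of_wlen (WithTop.coe_le_coe.1 h) (by omega)]
          · intro y hy hty
            have := hvmin y ⟨hy, hty⟩
            rcases hCc.total hv.1 hy with h | h
            · exact WithTop.coe_le_coe.1 h
            · rw [eq_of_le_of_wlen (WithTop.coe_le_coe.1 h) (by omega)]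
        · obtain ⟨v, hv1, hv2⟩ := exists_full u
          refine ⟨v, hv1, by omega, ?_⟩
          intro y hy hty
          exact absurd ⟨y, by simp [Up, hy, hty]⟩ hUp
      obtain ⟨v, huv, htv, hvy⟩ := hv
      obtain ⟨x, hx1, hx2, hx3⟩ := exists_between_sublist u.1 v.1 huv t hu.2 htv
      let X : InjWord n := ⟨x, v.2.sublist hx2⟩
      have hXt : wlen X = t := hx3
      have hXC : (X : WithTop (InjWord n)) ∈ C := by
        apply hins
        · left
          change rkInj n X ∈ T
          rw [rkInj_coe, hXt]
          exact ht
        · intro y hy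
          induction y with
          | top => exact Or.inl le_top
          | coe y =>
            rcases Nat.le_total (wlen y) t with h | h
            · right
              have hyu : y ≤ u := by
                have := humax y ⟨hy, h⟩
                rcases hCc.total hy hu.1 with h | h
                · exact WithTop.coe_le_coe.1 h
                · rw [eq_of_le_of_wlen (WithTop.coe_le_coe.1 h) (by omega)]
              exact WithTop.coe_le_coe.2 (hyu.trans hx1)
            · left
              exact WithTop.coe_le_coe.2 (le_trans (show X ≤ v from hx2) (hvy y hy h))
      exact Finset.mem_image.2 ⟨X, (hmemD X).2 ⟨hXC, hXt ▸ ht⟩, hXt⟩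
  · ext x
    induction x with
    | top => simp [toC, htop]
    | coe x =>
      rw [coe_mem_toC, hmemD]
      constructor
      · rintro (rfl | h)
        · rw [coe_bot']; exact hbot
        · exact h.1
      · intro h
        rcases hCA h with h2 | h2
        · right; exact ⟨h, h2⟩
        · left
          simp only [Set.mem_insert_iff, Set.mem_singleton_iff, WithTop.coe_ne_top, or_false] at h2
          rw [← coe_bot'] at h2
          exact WithTop.coe_injective h2

theorem wlen_permWord {n : ℕ} (g : Equiv.Perm (Fin n)) (u : InjWord n) :
    wlen (permWord g u) = wlen u := by
  simp [wlen, permWord]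

theorem image_toC_iff {n : ℕ} (g : Equiv.Perm (Fin n)) (D : Finset (InjWord n))
    (hD : IsChain (· ≤ ·) (D : Set (InjWord n))) (h0 : ⊥ ∉ D) :
    WithTop.map (permWord g) '' toC D = toC D ↔ ∀ u ∈ D, permWord g u = u := by
  have hb : permWord g (⊥ : InjWord n) = ⊥ := rfl
  constructor
  · intro h u hu
    have h1 : WithTop.map (permWord g) (u : WithTop (InjWord n)) ∈ toC D := by
      rw [← h]
      exact Set.mem_image_of_mem _ ((coe_mem_toC _ _).2 (Or.inr hu))
    rw [WithTop.map_coe, coe_mem_toC] at h1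
    have hl := wlen_permWord g u
    rcases h1 with h1 | h1
    · exfalso
      rw [h1, wlen_bot] at hl
      have : u = ⊥ := (eq_of_le_of_wlen bot_le (by omega)).symm
      exact h0 (this ▸ hu)
    · rcases hD.total h1 hu with h2 | h2
      · exact eq_of_le_of_wlen h2 (by omega)
      · exact (eq_of_le_of_wlen h2 (by omega)).symm
  · intro h
    have : ∀ x ∈ toC D, WithTop.map (permWord g) x = x := by
      intro x hx
      induction x with
      | top => rfl
      | coe x =>
        rw [coe_mem_toC] at hx
        rw [WithTop.map_coe]
        rcases hx with rfl | hx
        · rw [hb]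
        · rw [h x hx]
    rw [Set.image_congr this, Set.image_id']

theorem injAlpha_eq {n : ℕ} (T : Finset ℕ) (hT : T ⊆ Finset.Icc 1 n) (g : Equiv.Perm (Fin n)) :
    injAlpha n T g = (Nat.card {D // IsCh T {u | permWord g u = u} D} : ℤ) := by
  unfold injAlpha gAlpha
  rw [← Nat.card_coe_set_eq]
  congr 1
  have h0 : ∀ D : Finset (InjWord n), D.image wlen = T → ⊥ ∉ D := by
    intro D hD hb
    have : 0 ∈ T := by
      rw [← hD, ← wlen_bot (n := n)]
      exact Finset.mem_image_of_mem _ hb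
    have := Finset.mem_Icc.1 (hT this)
    omega
  symm
  apply Nat.card_eq_of_bijective (fun D => ⟨toC D.1, toC_maximal T hT D.1 D.2.1 D.2.2.1,
    (image_toC_iff g D.1 D.2.1 (h0 _ D.2.2.1)).2 D.2.2.2⟩)
  constructor
  · rintro ⟨D, hD⟩ ⟨D', hD'⟩ h
    have h := congrArg Subtype.val h
    simp only at h
    apply Subtype.ext
    ext u
    by_cases hu : u = ⊥
    · subst hu
      simp [h0 D hD.2.1, h0 D' hD'.2.1]
    · have h1 := coe_mem_toC D u
      have h2 := coe_mem_toC D' u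
      rw [h] at h1
      simp only [hu, false_or] at h1 h2
      exact h1.symm.trans h2
  · rintro ⟨C, hC, hCg⟩
    obtain ⟨D, hD1, hD2, rfl⟩ := exists_of_maximal T hT C hC
    exact ⟨⟨D, hD1, hD2, (image_toC_iff g D hD1 (h0 _ hD2)).1 hCg⟩, rfl⟩

theorem injAlpha_empty {n : ℕ} (g : Equiv.Perm (Fin n)) : injAlpha n ∅ g = 1 := by
  rw [injAlpha_eq ∅ (by simp), card_IsCh_empty]; simp

theorem injAlpha_insert {n : ℕ} (t : ℕ) (T : Finset ℕ) (h : insert t T ⊆ Finset.Icc 1 n)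
    (hT : ∀ x ∈ T, x < t) (g : Equiv.Perm (Fin n)) :
    injAlpha n (insert t T) g = (fixW n t g : ℤ) * (aNum t T : ℤ) := by
  rw [injAlpha_eq _ h, card_IsCh_fix g t T hT]; simp


theorem exists_perm_of_fibers {α β : Type*} [Finite α] (f f' : α → β)
    (h : ∀ b, Nat.card {a // f a = b} = Nat.card {a // f' a = b}) :
    ∃ g : Equiv.Perm α, ∀ a, f' (g a) = f a := by
  let e : ∀ b, ({a // f a = b} ≃ {a // f' a = b}) := fun b =>
    (Finite.equivFinOfCardEq (h b)).trans (Finite.equivFin _).symm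
  refine ⟨(Equiv.sigmaFiberEquiv f).symm.trans
    ((Equiv.sigmaCongrRight e).trans (Equiv.sigmaFiberEquiv f')), ?_⟩
  intro a
  simp only [Equiv.trans_apply]
  exact (e (f a) ⟨a, rfl⟩).2

/-- pairs of a word and an ordered set partition -/
def YX (n t r : ℕ) (c : Fin r → ℤ) : Type :=
  {q : (Fin t ↪ Fin n) × (Fin n → Fin r) //
    ∀ i, ((Nat.card {x : Fin n // q.2 x = i} : ℕ) : ℤ) = c i}

instance finite_YX (n t r : ℕ) (c : Fin r → ℤ) : Finite (YX n t r c) :=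
  inferInstanceAs (Finite {q : (Fin t ↪ Fin n) × (Fin n → Fin r) //
    ∀ i, ((Nat.card {x : Fin n // q.2 x = i} : ℕ) : ℤ) = c i})

theorem card_fiber_comp {n r : ℕ} (f : Fin n → Fin r) (g : Equiv.Perm (Fin n)) (i : Fin r) :
    Nat.card {x : Fin n // f (g x) = i} = Nat.card {x : Fin n // f x = i} :=
  Nat.card_congr (g.subtypeEquiv (fun _ => Iff.rfl))

noncomputable instance mulAction_YX (n t r : ℕ) (c : Fin r → ℤ) :
    MulAction (Equiv.Perm (Fin n)) (YX n t r c) where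
  smul g q := ⟨(q.1.1.trans g.toEmbedding, fun x => q.1.2 (g⁻¹ x)), fun i => by
    rw [← q.2 i, card_fiber_comp]⟩
  one_smul q := by
    apply Subtype.ext
    rfl
  mul_smul g h q := by
    apply Subtype.ext
    apply Prod.ext
    · rfl
    · funext x
      change q.1.2 ((g * h)⁻¹ x) = q.1.2 (h⁻¹ (g⁻¹ x))
      rw [mul_inv_rev]; rfl

/-- number of words `p` in the letters `Fin r` of length `t` with content bounded by `c` -/
noncomputable def Npos (t : ℕ) {r : ℕ} (c : Fin r → ℤ) : ℕ :=
  Nat.card {p : Fin t → Fin r // ∀ i, ((Nat.card {j : Fin t // p j = i} : ℕ) : ℤ) ≤ c i}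

theorem card_fiber_split {n t r : ℕ} (u : Fin t ↪ Fin n) (f : Fin n → Fin r) (i : Fin r) :
    Nat.card {x : Fin n // f x = i} = Nat.card {j : Fin t // f (u j) = i} +
      Nat.card {x : Fin n // f x = i ∧ ∀ j, u j ≠ x} := by
  rw [Nat.card_eq_fintype_card, Nat.card_eq_fintype_card, Nat.card_eq_fintype_card,
    Fintype.card_subtype, Fintype.card_subtype, Fintype.card_subtype]
  rw [← Finset.card_map u, ← Finset.card_union_of_disjoint]
  · congr 1
    ext x
    simp only [Finset.mem_filter, Finset.mem_univ, true_and, Finset.mem_union, Finset.mem_map]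
    constructor
    · intro h
      by_cases hx : ∀ j, u j ≠ x
      · exact Or.inr ⟨h, hx⟩
      · push Not at hx
        obtain ⟨j, rfl⟩ := hx
        exact Or.inl ⟨j, h, rfl⟩
    · rintro (⟨j, hj, rfl⟩ | h)
      · exact hj
      · exact h.1
  · rw [Finset.disjoint_left]
    intro x hx hx'
    simp only [Finset.mem_filter, Finset.mem_univ, true_and, Finset.mem_map] at hx hx'
    obtain ⟨j, hj, rfl⟩ := hx
    exact hx'.2 j rfl

theorem YX_orbit {n t r : ℕ} {c : Fin r → ℤ} (q q' : YX n t r c)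
    (h : ∀ j, q.1.2 (q.1.1 j) = q'.1.2 (q'.1.1 j)) : ∃ g : Equiv.Perm (Fin n), g • q = q' := by
  let H : YX n t r c → Fin n → Fin r × Option (Fin t) := fun q x =>
    (q.1.2 x, if h : ∃ j, q.1.1 j = x then some h.choose else none)
  have Hsome : ∀ (q : YX n t r c) x j, (H q x).2 = some j ↔ q.1.1 j = x := by
    intro q x j
    simp only [H]
    split_ifs with hx
    · constructor
      · intro h2
        rw [Option.some.injEq] at h2
        rw [← h2]; exact hx.choose_spec
      · intro h2
        rw [Option.some.injEq]
        exact q.1.1.injective (hx.choose_spec.trans h2.symm)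
    · simp only [reduceCtorEq, false_iff]
      exact fun h2 => hx ⟨j, h2⟩
  have Hnone : ∀ (q : YX n t r c) x, (H q x).2 = none ↔ ∀ j, q.1.1 j ≠ x := by
    intro q x
    simp only [H]
    split_ifs with hx
    · simp only [reduceCtorEq, false_iff]
      exact fun h2 => h2 _ hx.choose_spec
    · push Not at hx
      simpa using hx
  obtain ⟨g, hg⟩ := exists_perm_of_fibers (H q) (H q') (by
    rintro ⟨i, o⟩
    cases o with
    | none =>
      have h1 : ∀ q : YX n t r c, Nat.card {x // H q x = (i, none)} =
          Nat.card {x : Fin n // q.1.2 x = i ∧ ∀ j, q.1.1 j ≠ x} := by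
        intro q
        apply Nat.card_congr
        apply Equiv.subtypeEquivRight
        intro x
        rw [Prod.ext_iff]
        simp only
        rw [Hnone]
      rw [h1, h1]
      have h2 := card_fiber_split q.1.1 q.1.2 i
      have h3 := card_fiber_split q'.1.1 q'.1.2 i
      have h4 := q.2 i
      have h5 := q'.2 i
      simp_rw [h] at h2
      omega
    | some j =>
      have h1 : ∀ q : YX n t r c, Nat.card {x // H q x = (i, some j)} =
          if q.1.2 (q.1.1 j) = i then 1 else 0 := by
        intro q
        have : ∀ x, H q x = (i, some j) ↔ x = q.1.1 j ∧ q.1.2 (q.1.1 j) = i := by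
          intro x
          rw [Prod.ext_iff]
          simp only
          rw [Hsome]
          constructor
          · rintro ⟨h1, h2⟩
            exact ⟨h2.symm, by rw [h2]; exact h1⟩
          · rintro ⟨rfl, h2⟩
            exact ⟨h2, rfl⟩
        simp_rw [this]
        split_ifs with h2
        · simp [h2]
        · simp [h2]
      rw [h1, h1, h])
  refine ⟨g, ?_⟩
  apply Subtype.ext
  apply Prod.ext
  · ext j
    change ((g (q.1.1 j) : Fin n) : ℕ) = q'.1.1 j
    congr 1
    have h1 := (Hsome q (q.1.1 j) j).2 rfl
    rw [← hg, Hsome] at h1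
    exact h1.symm
  · funext x
    change q.1.2 (g⁻¹ x) = q'.1.2 x
    have := congrArg Prod.fst (hg (g⁻¹ x))
    have h2 : g (g⁻¹ x) = x := g.apply_symm_apply x
    rw [h2] at this
    exact this.symm

theorem YX_exists {n t r : ℕ} (c : Fin r → ℤ) (hc : ∑ i, c i = n) (p : Fin t → Fin r)
    (hp : ∀ i, ((Nat.card {j : Fin t // p j = i} : ℕ) : ℤ) ≤ c i) :
    ∃ q : YX n t r c, ∀ j, q.1.2 (q.1.1 j) = p j := by
  have hc0 : ∀ i, 0 ≤ c i := fun i => le_trans (by positivity) (hp i)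
  have e : Fin n ≃ (Σ i : Fin r, Fin (c i).toNat) := by
    apply Fintype.equivOfCardEq
    rw [Fintype.card_fin, Fintype.card_sigma]
    simp only [Fintype.card_fin]
    have : ((∑ i, (c i).toNat : ℕ) : ℤ) = n := by
      rw [← hc]
      push_cast
      exact Finset.sum_congr rfl (fun i _ => by simp [hc0 i])
    exact_mod_cast this.symm
  let f : Fin n → Fin r := fun x => (e x).1
  have hf : ∀ i, Nat.card {x // f x = i} = (c i).toNat := by
    intro i
    have : Nat.card {x // f x = i} = Nat.card {y : (Σ i : Fin r, Fin (c i).toNat) // y.1 = i} :=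
      Nat.card_congr (e.subtypeEquiv (fun _ => Iff.rfl))
    rw [this, Nat.card_congr (Equiv.sigmaSubtype i)]
    simp
  have hemb : ∀ i, Nonempty ({j : Fin t // p j = i} ↪ {x // f x = i}) := by
    intro i
    apply Function.Embedding.nonempty_of_card_le
    rw [← Nat.card_eq_fintype_card, ← Nat.card_eq_fintype_card, hf]
    have := hp i
    omega
  let E : ∀ i, ({j : Fin t // p j = i} ↪ {x // f x = i}) := fun i => Classical.choice (hemb i)
  have hE : ∀ i (z : {j : Fin t // p j = i}), f (E i z).1 = i := fun i z => (E i z).2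
  let u : Fin t → Fin n := fun j => (E (p j) ⟨j, rfl⟩).1
  have hu : ∀ j, f (u j) = p j := fun j => hE _ _
  have huE : ∀ j i (h : p j = i), u j = (E i ⟨j, h⟩).1 := by
    intro j i h
    subst h
    rfl
  have hinj : Function.Injective u := by
    intro j k hjk
    have h1 : p j = p k := by rw [← hu, ← hu, hjk]
    rw [huE j (p k) h1, huE k (p k) rfl] at hjk
    have := (E (p k)).injective (Subtype.ext hjk)
    simpa using this
  exact ⟨⟨(⟨u, hinj⟩, f), fun i => by
    change ((Nat.card {x // f x = i} : ℕ) : ℤ) = c i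
    rw [hf]; simp [hc0 i]⟩, hu⟩

theorem card_orbits_YX {n t r : ℕ} (c : Fin r → ℤ) (hc : ∑ i, c i = n) :
    Nat.card (Quotient (MulAction.orbitRel (Equiv.Perm (Fin n)) (YX n t r c))) = Npos t c := by
  have hle : ∀ q : YX n t r c, ∀ i,
      ((Nat.card {j : Fin t // q.1.2 (q.1.1 j) = i} : ℕ) : ℤ) ≤ c i := by
    intro q i
    rw [← q.2 i, card_fiber_split q.1.1 q.1.2 i]
    push_cast
    omega
  apply Nat.card_eq_of_bijective (Quotient.lift
    (fun q : YX n t r c => (⟨fun j => q.1.2 (q.1.1 j), hle q⟩ :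
      {p : Fin t → Fin r // ∀ i, ((Nat.card {j : Fin t // p j = i} : ℕ) : ℤ) ≤ c i})) (by
      intro a b hab
      obtain ⟨g, rfl⟩ := hab
      apply Subtype.ext
      funext j
      change b.1.2 (g⁻¹ (g (b.1.1 j))) = _
      simp))
  constructor
  · intro a b
    induction a using Quotient.inductionOn with | _ a =>
    induction b using Quotient.inductionOn with | _ b =>
    intro hab
    simp only [Quotient.lift_mk, Subtype.mk.injEq] at hab
    obtain ⟨g, hg⟩ := YX_orbit b a (fun j => (congrFun hab j).symm)
    exact Quotient.sound ⟨g, hg⟩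
  · rintro ⟨p, hp⟩
    obtain ⟨q, hq⟩ := YX_exists c hc p hp
    exact ⟨Quotient.mk _ q, Subtype.ext (funext hq)⟩

theorem fixW_eq (n t : ℕ) (g : Equiv.Perm (Fin n)) :
    fixW n t g = Nat.card {u : Fin t ↪ Fin n // ∀ j, g (u j) = u j} := by
  unfold fixW
  symm
  apply Nat.card_eq_of_bijective (fun u => ⟨⟨List.ofFn u.1, List.nodup_ofFn.2 u.1.injective⟩, by
    refine ⟨?_, ?_⟩
    · refine (permWord_eq_iff g _).2 ?_
      intro x hx
      simp only [List.mem_ofFn] at hx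
      obtain ⟨j, rfl⟩ := hx
      exact u.2 j
    · simp [wlen]⟩)
  constructor
  · rintro ⟨u, hu⟩ ⟨u', hu'⟩ h
    have h := congrArg Subtype.val (congrArg Subtype.val h)
    simp only at h
    have := List.ofFn_injective h
    exact Subtype.ext (DFunLike.coe_injective this)
  · rintro ⟨⟨l, hnd⟩, hg, hl⟩
    have hg := (permWord_eq_iff g _).1 hg
    have hl : l.length = t := hl
    subst hl
    refine ⟨⟨⟨l.get, List.nodup_iff_injective_get.1 hnd⟩, ?_⟩, ?_⟩
    · intro j
      exact hg _ (List.get_mem l j)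
    · apply Subtype.ext
      apply Subtype.ext
      exact List.ofFn_get l

theorem burnside_YX {n t r : ℕ} (c : Fin r → ℤ) (hc : ∑ i, c i = n) :
    ∑ g : Equiv.Perm (Fin n), fixW n t g * fixedYoungFns n r c g⁻¹ = Npos t c * n.factorial := by
  have := Fintype.ofFinite (YX n t r c)
  have := Fintype.ofFinite (Quotient (MulAction.orbitRel (Equiv.Perm (Fin n)) (YX n t r c)))
  have h := MulAction.sum_card_fixedBy_eq_card_orbits_mul_card_group (Equiv.Perm (Fin n)) (YX n t r c)
  rw [← Nat.card_eq_fintype_card, card_orbits_YX c hc, Fintype.card_perm, Fintype.card_fin] at h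
  rw [← h]
  apply Finset.sum_congr rfl
  intro g _
  rw [fixW_eq, ← Nat.card_eq_fintype_card, fixedYoungFns, ← Nat.card_prod]
  apply Nat.card_congr
  exact
    { toFun := fun p => ⟨⟨(p.1.1, p.2.1), p.2.2.2⟩, by
        apply Subtype.ext
        apply Prod.ext
        · ext j
          exact congrArg Fin.val (p.1.2 j)
        · funext x
          exact p.2.2.1 x⟩
      invFun := fun q => (⟨q.1.1.1, fun j => by
          have := q.2
          rw [MulAction.mem_fixedBy] at this
          have := congrArg Prod.fst (congrArg Subtype.val this)
          exact DFunLike.congr_fun this j⟩, ⟨q.1.1.2, fun x => by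
          have := q.2
          rw [MulAction.mem_fixedBy] at this
          have := congrArg Prod.snd (congrArg Subtype.val this)
          exact congrFun this x, q.1.2⟩)
      left_inv := fun p => rfl
      right_inv := fun q => rfl }


theorem SYT.ext_entry {μ : YoungDiagram} (Q Q' : SYT μ) (h : Q.entry = Q'.entry) : Q = Q' := by
  cases Q; cases Q'; simp only at h; subst h; rfl

theorem SYT.entry_mem {μ : YoungDiagram} (Q : SYT μ) (i j : ℕ) (h : (i, j) ∈ μ) :
    1 ≤ Q.entry i j ∧ Q.entry i j ≤ μ.card := by
  have := Q.bijOn.1 (show (i, j) ∈ (μ.cells : Set (ℕ × ℕ)) from h)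
  simpa using this

theorem SYT.entry_inj {μ : YoungDiagram} (Q : SYT μ) (p q : ℕ × ℕ) (hp : p ∈ μ) (hq : q ∈ μ)
    (h : Q.entry p.1 p.2 = Q.entry q.1 q.2) : p = q :=
  Q.bijOn.2.1 (show p ∈ (μ.cells : Set (ℕ × ℕ)) from hp)
    (show q ∈ (μ.cells : Set (ℕ × ℕ)) from hq) h

theorem SYT.exists_entry {μ : YoungDiagram} (Q : SYT μ) (k : ℕ) (h1 : 1 ≤ k) (h2 : k ≤ μ.card) :
    ∃ p : ℕ × ℕ, p ∈ μ ∧ Q.entry p.1 p.2 = k := by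
  obtain ⟨p, hp, h⟩ := Q.bijOn.2.2 (show k ∈ ((Finset.Icc 1 μ.card : Finset ℕ) : Set ℕ) by
    simp [h1, h2])
  exact ⟨p, hp, h⟩

instance finite_SYT (μ : YoungDiagram) : Finite (SYT μ) := by
  apply Finite.of_injective (β := {p // p ∈ μ.cells} → Fin (μ.card + 1))
    (fun Q p => ⟨Q.entry p.1.1 p.1.2, by
      have := (Q.entry_mem p.1.1 p.1.2 p.2).2
      omega⟩)
  intro Q Q' h
  apply SYT.ext_entry
  funext i j
  by_cases hij : (i, j) ∈ μ
  · have := congrFun h ⟨(i, j), hij⟩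
    simpa using this
  · rw [Q.entry_eq_zero i j hij, Q'.entry_eq_zero i j hij]

/-- remove the last cell of row `i` (if this is a corner) -/
def rmC (μ : YoungDiagram) (i : ℕ) : YoungDiagram where
  cells := μ.cells.filter (fun p => ¬ (i ≤ p.1 ∧ μ.rowLen i ≤ p.2 + 1))
  isLowerSet := by
    intro p q hqp hp
    simp only [Finset.coe_filter, Set.mem_ofPred_eq] at hp ⊢
    refine ⟨μ.isLowerSet hqp hp.1, ?_⟩
    intro h
    apply hp.2
    have h1 : q.1 ≤ p.1 := hqp.1
    have h2 : q.2 ≤ p.2 := hqp.2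
    omega

theorem mem_rmC {μ : YoungDiagram} {i : ℕ} (h : μ.rowLen (i + 1) < μ.rowLen i) (a b : ℕ) :
    (a, b) ∈ rmC μ i ↔ (a, b) ∈ μ ∧ ¬ (a = i ∧ b + 1 = μ.rowLen i) := by
  rw [← YoungDiagram.mem_cells]
  simp only [rmC, Finset.mem_filter, YoungDiagram.mem_cells]
  apply and_congr_right
  intro hab
  rw [YoungDiagram.mem_iff_lt_rowLen] at hab
  apply not_congr
  constructor
  · rintro ⟨h1, h2⟩
    rcases Nat.eq_or_lt_of_le h1 with h3 | h3
    · subst h3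
      exact ⟨rfl, by omega⟩
    · have := μ.rowLen_anti (i + 1) a h3
      omega
  · rintro ⟨rfl, h2⟩
    exact ⟨le_rfl, h2.ge⟩

theorem rowLen_eq_of {μ : YoungDiagram} (i k : ℕ) (h : ∀ j, (i, j) ∈ μ ↔ j < k) :
    μ.rowLen i = k := by
  have h1 := h k
  have h2 := h (μ.rowLen i)
  rw [YoungDiagram.mem_iff_lt_rowLen] at h1 h2
  omega

theorem rowLen_rmC {μ : YoungDiagram} {i : ℕ} (h : μ.rowLen (i + 1) < μ.rowLen i) (a : ℕ) :
    (rmC μ i).rowLen a = if a = i then μ.rowLen i - 1 else μ.rowLen a := by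
  apply rowLen_eq_of
  intro j
  rw [mem_rmC h, YoungDiagram.mem_iff_lt_rowLen]
  split_ifs with ha
  · subst ha; omega
  · simp [ha]

theorem cells_rmC {μ : YoungDiagram} {i : ℕ} (h : μ.rowLen (i + 1) < μ.rowLen i) :
    (rmC μ i).cells = μ.cells.erase (i, μ.rowLen i - 1) := by
  ext ⟨a, b⟩
  rw [YoungDiagram.mem_cells, mem_rmC h, Finset.mem_erase, YoungDiagram.mem_cells, and_comm]
  apply and_congr_left
  intro _
  rw [Ne, Prod.mk.injEq]
  omega

theorem card_rmC {μ : YoungDiagram} {i : ℕ} (h : μ.rowLen (i + 1) < μ.rowLen i) :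
    (rmC μ i).card + 1 = μ.card := by
  have hm : (i, μ.rowLen i - 1) ∈ μ.cells := by
    rw [YoungDiagram.mem_cells, YoungDiagram.mem_iff_lt_rowLen]; omega
  unfold YoungDiagram.card
  rw [cells_rmC h, Finset.card_erase_add_one hm]

/-- condition that `1, …, m` are in the first row -/
def RowC {μ : YoungDiagram} (m : ℕ) (Q : SYT μ) : Prop :=
  ∀ k, 1 ≤ k → k ≤ m → ∃ j, (0, j) ∈ μ ∧ Q.entry 0 j = k

/-- put the largest entry at the end of row `i` -/
def extSYT {μ : YoungDiagram} {i : ℕ} (h : μ.rowLen (i + 1) < μ.rowLen i) (Q : SYT (rmC μ i)) :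
    SYT μ where
  entry a b := if a = i ∧ b + 1 = μ.rowLen i then μ.card else Q.entry a b
  entry_eq_zero a b hab := by
    rw [if_neg, Q.entry_eq_zero]
    · rw [mem_rmC h]; exact fun h' => hab h'.1
    · rintro ⟨rfl, hb⟩
      apply hab
      rw [YoungDiagram.mem_iff_lt_rowLen]; omega
  row_strict a b c hbc hc := by
    have hcard := card_rmC h
    have hb : ¬ (a = i ∧ b + 1 = μ.rowLen i) := by
      rintro ⟨rfl, hb⟩
      rw [YoungDiagram.mem_iff_lt_rowLen] at hc
      omega
    have hbm : (a, b) ∈ rmC μ i := by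
      rw [mem_rmC h]
      exact ⟨μ.up_left_mem le_rfl hbc.le hc, hb⟩
    rw [if_neg hb]
    split_ifs with h2
    · have := (Q.entry_mem a b hbm).2
      omega
    · exact Q.row_strict a b c hbc ((mem_rmC h a c).2 ⟨hc, h2⟩)
  col_strict a b c hab hc := by
    have hcard := card_rmC h
    have hb : ¬ (a = i ∧ c + 1 = μ.rowLen i) := by
      rintro ⟨rfl, hb⟩
      rw [YoungDiagram.mem_iff_lt_rowLen] at hc
      have := μ.rowLen_anti (a + 1) b hab
      omega
    have hbm : (a, c) ∈ rmC μ i := by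
      rw [mem_rmC h]
      exact ⟨μ.up_left_mem hab.le le_rfl hc, hb⟩
    rw [if_neg hb]
    split_ifs with h2
    · have := (Q.entry_mem a c hbm).2
      omega
    · exact Q.col_strict a b c hab ((mem_rmC h b c).2 ⟨hc, h2⟩)
  bijOn := by
    have hcard := card_rmC h
    have hcase : ∀ a b, (a, b) ∈ μ → (a = i ∧ b + 1 = μ.rowLen i) ∨
        (¬ (a = i ∧ b + 1 = μ.rowLen i) ∧ (a, b) ∈ rmC μ i) := by
      intro a b hab
      by_cases h2 : a = i ∧ b + 1 = μ.rowLen i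
      · exact Or.inl h2
      · exact Or.inr ⟨h2, (mem_rmC h a b).2 ⟨hab, h2⟩⟩
    refine ⟨?_, ?_, ?_⟩
    · rintro ⟨a, b⟩ hab
      have hab : (a, b) ∈ μ := hab
      simp only [Finset.coe_Icc, Set.mem_Icc]
      rcases hcase a b hab with h2 | ⟨h2, h3⟩
      · rw [if_pos h2]; omega
      · rw [if_neg h2]
        have := Q.entry_mem a b h3
        omega
    · rintro ⟨a, b⟩ hab ⟨c, d⟩ hcd heq
      have hab : (a, b) ∈ μ := hab
      have hcd : (c, d) ∈ μ := hcd
      simp only at heq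
      rcases hcase a b hab with h2 | ⟨h2, h3⟩ <;> rcases hcase c d hcd with h4 | ⟨h4, h5⟩
      · rw [Prod.mk.injEq]; omega
      · rw [if_pos h2, if_neg h4] at heq
        have := Q.entry_mem c d h5
        omega
      · rw [if_neg h2, if_pos h4] at heq
        have := Q.entry_mem a b h3
        omega
      · rw [if_neg h2, if_neg h4] at heq
        exact Q.entry_inj (a, b) (c, d) h3 h5 heq
    · intro k hk
      simp only [Finset.coe_Icc, Set.mem_Icc] at hk
      rcases Nat.lt_or_ge k μ.card with h2 | h2
      · obtain ⟨⟨a, b⟩, hp, hpk⟩ := Q.exists_entry k hk.1 (by omega)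
        rw [mem_rmC h] at hp
        refine ⟨(a, b), hp.1, ?_⟩
        simp only
        rw [if_neg hp.2]
        exact hpk
      · refine ⟨(i, μ.rowLen i - 1), ?_, ?_⟩
        · change (i, μ.rowLen i - 1) ∈ μ
          rw [YoungDiagram.mem_iff_lt_rowLen]; omega
        · simp only
          rw [if_pos ⟨trivial, by omega⟩]
          omega

/-- remove the largest entry, at the end of row `i` -/
def resSYT {μ : YoungDiagram} {i : ℕ} (h : μ.rowLen (i + 1) < μ.rowLen i) (Q : SYT μ)
    (hQ : Q.entry i (μ.rowLen i - 1) = μ.card) : SYT (rmC μ i) where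
  entry a b := if a = i ∧ b + 1 = μ.rowLen i then 0 else Q.entry a b
  entry_eq_zero a b hab := by
    split_ifs with h2
    · rfl
    · apply Q.entry_eq_zero
      intro h3
      exact hab ((mem_rmC h a b).2 ⟨h3, h2⟩)
  row_strict a b c hbc hc := by
    have hb : (a, b) ∈ rmC μ i := YoungDiagram.up_left_mem _ le_rfl hbc.le hc
    rw [mem_rmC h] at hb hc
    rw [if_neg hb.2, if_neg hc.2]
    exact Q.row_strict a b c hbc hc.1
  col_strict a b c hab hc := by
    have hb : (a, c) ∈ rmC μ i := YoungDiagram.up_left_mem _ hab.le le_rfl hc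
    rw [mem_rmC h] at hb hc
    rw [if_neg hb.2, if_neg hc.2]
    exact Q.col_strict a b c hab hc.1
  bijOn := by
    have hcard := card_rmC h
    have hcell : (i, μ.rowLen i - 1) ∈ μ := by
      rw [YoungDiagram.mem_iff_lt_rowLen]; omega
    refine ⟨?_, ?_, ?_⟩
    · rintro ⟨a, b⟩ hab
      have hab : (a, b) ∈ rmC μ i := hab
      rw [mem_rmC h] at hab
      simp only [Finset.coe_Icc, Set.mem_Icc]
      rw [if_neg hab.2]
      have h1 := Q.entry_mem a b hab.1
      have h2 : Q.entry a b ≠ μ.card := by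
        intro h2
        rw [← hQ] at h2
        have := Q.entry_inj (a, b) (i, μ.rowLen i - 1) hab.1 hcell h2
        rw [Prod.mk.injEq] at this
        apply hab.2
        omega
      omega
    · rintro ⟨a, b⟩ hab ⟨c, d⟩ hcd heq
      have hab : (a, b) ∈ rmC μ i := hab
      have hcd : (c, d) ∈ rmC μ i := hcd
      rw [mem_rmC h] at hab hcd
      simp only at heq
      rw [if_neg hab.2, if_neg hcd.2] at heq
      exact Q.entry_inj (a, b) (c, d) hab.1 hcd.1 heq
    · intro k hk
      simp only [Finset.coe_Icc, Set.mem_Icc] at hk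
      obtain ⟨⟨a, b⟩, hp, hpk⟩ := Q.exists_entry k hk.1 (by omega)
      have h2 : ¬ (a = i ∧ b + 1 = μ.rowLen i) := by
        rintro ⟨rfl, hb⟩
        have : b = μ.rowLen a - 1 := by omega
        subst this
        simp only at hpk
        omega
      refine ⟨(a, b), (mem_rmC h a b).2 ⟨hp, h2⟩, ?_⟩
      simp only
      rw [if_neg h2]
      exact hpk

theorem fSYTRow_rec (μ : YoungDiagram) (m r : ℕ) (hr : μ.rowLen r = 0) (hm : m < μ.card) :
    fSYTRow μ m = ∑ i : Fin r, if μ.rowLen (i + 1) < μ.rowLen i then fSYTRow (rmC μ i) m else 0 := by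
  have h1 : Nat.card {Q : SYT μ // RowC m Q} = Nat.card
      (Σ i : {i : Fin r // μ.rowLen (i + 1) < μ.rowLen i}, {Q : SYT (rmC μ i.1) // RowC m Q}) := by
    symm
    apply Nat.card_eq_of_bijective (fun p => ⟨extSYT p.1.2 p.2.1, by
      obtain ⟨⟨i, hi⟩, ⟨Q, hQ⟩⟩ := p
      intro k h1 h2
      obtain ⟨j, hj, hjk⟩ := hQ k h1 h2
      rw [mem_rmC hi] at hj
      refine ⟨j, hj.1, ?_⟩
      simp only [extSYT]
      rw [if_neg hj.2]
      exact hjk⟩)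
    constructor
    · rintro ⟨⟨i, hi⟩, ⟨Q, hQ⟩⟩ ⟨⟨i', hi'⟩, ⟨Q', hQ'⟩⟩ heq
      have heq := congrArg SYT.entry (congrArg Subtype.val heq)
      simp only [extSYT] at heq
      have hii : i = i' := by
        have h1 := congrFun (congrFun heq i) (μ.rowLen i - 1)
        rw [if_pos ⟨rfl, by omega⟩] at h1
        split_ifs at h1 with h2
        · exact Fin.ext h2.1
        · exfalso
          have h3 : ((i : ℕ), μ.rowLen i - 1) ∈ rmC μ i' := by
            rw [mem_rmC hi']
            refine ⟨?_, h2⟩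
            rw [YoungDiagram.mem_iff_lt_rowLen]; omega
          have h4 : Q'.entry i (μ.rowLen i - 1) ≤ (rmC μ i').card := (Q'.entry_mem _ _ h3).2
          have := card_rmC hi'
          omega
      subst hii
      have hQQ : Q = Q' := by
        apply SYT.ext_entry
        funext a b
        by_cases h2 : a = i ∧ b + 1 = μ.rowLen i
        · have h3 : (a, b) ∉ rmC μ i := by
            rw [mem_rmC hi]; exact fun h => h.2 h2
          rw [Q.entry_eq_zero _ _ h3, Q'.entry_eq_zero _ _ h3]
        · have h1 := congrFun (congrFun heq a) b
          rwa [if_neg h2, if_neg h2] at h1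
      subst hQQ
      rfl
    · rintro ⟨Q, hQ⟩
      obtain ⟨⟨a, b⟩, hab, hk⟩ := Q.exists_entry μ.card (by omega) le_rfl
      simp only at hk
      have hb : (a, b + 1) ∉ μ := by
        intro h2
        have h3 := Q.row_strict a b (b + 1) (by omega) h2
        have h4 := (Q.entry_mem _ _ h2).2
        omega
      have ha : (a + 1, b) ∉ μ := by
        intro h2
        have h3 := Q.col_strict a (a + 1) b (by omega) h2
        have h4 := (Q.entry_mem _ _ h2).2
        omega
      rw [YoungDiagram.mem_iff_lt_rowLen] at hab ha hb
      have hrow : μ.rowLen a = b + 1 := by omega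
      have har : a < r := by
        by_contra hc
        have := μ.rowLen_anti r a (by omega)
        omega
      have hc : μ.rowLen (a + 1) < μ.rowLen a := by omega
      have hQa : Q.entry a (μ.rowLen a - 1) = μ.card := by
        rw [hrow]; exact hk
      refine ⟨⟨⟨⟨a, har⟩, hc⟩, ⟨resSYT hc Q hQa, ?_⟩⟩, ?_⟩
      · intro k h1 h2
        obtain ⟨j, hj, hjk⟩ := hQ k h1 h2
        have hne : ¬ (0 = a ∧ j + 1 = μ.rowLen a) := by
          rintro ⟨rfl, h3⟩
          have : j = μ.rowLen 0 - 1 := by omega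
          subst this
          omega
        refine ⟨j, (mem_rmC hc 0 j).2 ⟨hj, hne⟩, ?_⟩
        simp only [resSYT]
        rw [if_neg hne]
        exact hjk
      · apply Subtype.ext
        apply SYT.ext_entry
        funext c d
        simp only [extSYT, resSYT]
        split_ifs with h2
        · obtain ⟨rfl, h2⟩ := h2
          have : d = μ.rowLen c - 1 := by omega
          rw [this, hQa]
        · rfl
  have h2 : fSYTRow μ m = Nat.card {Q : SYT μ // RowC m Q} := rfl
  rw [h2, h1, Nat.card_sigma]
  rw [← Finset.sum_filter]
  exact (Finset.sum_subtype (Finset.univ.filter (fun i : Fin r => μ.rowLen (i + 1) < μ.rowLen i))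
    (p := fun i : Fin r => μ.rowLen (i + 1) < μ.rowLen i) (by simp)
    (fun i => fSYTRow (rmC μ i) m)).symm

theorem RowC_iff {μ : YoungDiagram} (m : ℕ) (hm : m ≤ μ.card) (Q : SYT μ) :
    RowC m Q ↔ ∀ d ∈ Q.des, m ≤ d := by
  constructor
  · intro h d hd
    simp only [SYT.des, Finset.mem_filter, Finset.mem_Icc] at hd
    obtain ⟨⟨h1, h2⟩, p1, hp1, p2, hp2, e1, e2, hlt⟩ := hd
    by_contra hc
    obtain ⟨j, hj, hjk⟩ := h (d + 1) (by omega) (by omega)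
    have := Q.entry_inj (0, j) p2 hj hp2 (by simp only; omega)
    rw [← this] at hlt
    simp at hlt
  · intro h k h1
    induction k, h1 using Nat.le_induction with
    | base =>
      intro h2
      obtain ⟨⟨a, b⟩, hp, hk⟩ := Q.exists_entry 1 le_rfl (by omega)
      simp only at hk
      have : a = 0 := by
        by_contra ha
        have h3 := Q.col_strict 0 a b (by omega) hp
        have h4 := Q.entry_mem 0 b (μ.up_left_mem (Nat.zero_le a) le_rfl hp)
        omega
      subst this
      exact ⟨b, hp, hk⟩
    | succ k hk ih =>
      intro h2
      obtain ⟨j, hj, hjk⟩ := ih (by omega)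
      obtain ⟨⟨a, b⟩, hp, hpk⟩ := Q.exists_entry (k + 1) (by omega) (by omega)
      simp only at hpk
      have : a = 0 := by
        by_contra ha
        have hd : k ∈ Q.des := by
          simp only [SYT.des, Finset.mem_filter, Finset.mem_Icc]
          exact ⟨⟨hk, by omega⟩, (0, j), hj, (a, b), hp, hjk, hpk, by simp only; omega⟩
        have := h k hd
        omega
      subst this
      exact ⟨b, hp, hpk⟩


theorem Npos_eq_sum (t : ℕ) {r : ℕ} (c : Fin r → ℤ) :
    Npos t c = ∑ p : Fin t → Fin r,
      if ∀ i, (((Finset.univ.filter fun j => p j = i).card : ℕ) : ℤ) ≤ c i then 1 else 0 := by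
  unfold Npos
  rw [Nat.card_eq_fintype_card, Fintype.card_subtype, Finset.card_filter]
  refine Finset.sum_congr rfl fun p _ => ?_
  simp only [Nat.card_eq_fintype_card, Fintype.card_subtype]

theorem Npos_zero {r : ℕ} (c : Fin r → ℤ) : Npos 0 c = if ∀ i, 0 ≤ c i then 1 else 0 := by
  rw [Npos_eq_sum]
  simp

theorem Npos_succ (t : ℕ) {r : ℕ} (c : Fin r → ℤ) :
    Npos (t + 1) c = ∑ i, Npos t (fun a => c a - if a = i then 1 else 0) := by
  simp only [Npos_eq_sum]
  rw [← (Fin.consEquiv (fun _ : Fin (t + 1) => Fin r)).sum_comp, Fintype.sum_prod_type]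
  refine Finset.sum_congr rfl fun i _ => Finset.sum_congr rfl fun p _ => ?_
  congr 1
  apply propext
  refine forall_congr' fun a => ?_
  have : (Finset.univ.filter fun j : Fin (t + 1) =>
      (Fin.consEquiv (fun _ : Fin (t + 1) => Fin r)) (i, p) j = a).card =
      (if a = i then 1 else 0) + (Finset.univ.filter fun j => p j = a).card := by
    rw [Fin.card_filter_univ_succ']
    simp only [Fin.consEquiv_apply, Fin.cons_zero, Fin.cons_succ, eq_comm]
  rw [this]
  push_cast
  constructor <;> intro h <;> linarith

theorem Npos_comp (t : ℕ) {r : ℕ} (c : Fin r → ℤ) (π : Equiv.Perm (Fin r)) :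
    Npos t (fun a => c (π a)) = Npos t c := by
  simp only [Npos_eq_sum]
  refine Fintype.sum_equiv ((Equiv.refl (Fin t)).arrowCongr π) _ _ fun p => ?_
  congr 1
  apply propext
  constructor
  · intro h a
    have := h (π.symm a)
    simpa [Equiv.arrowCongr, Equiv.eq_symm_apply] using this
  · intro h a
    have := h (π a)
    simpa [Equiv.arrowCongr] using this

theorem Npos_neg (t : ℕ) {r : ℕ} (c : Fin r → ℤ) (i : Fin r) (h : c i < 0) : Npos t c = 0 := by
  rw [Npos_eq_sum]
  refine Finset.sum_eq_zero fun p _ => if_neg fun h2 => ?_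
  have := h2 i
  omega

noncomputable def JT (t : ℕ) {r : ℕ} (ν : Fin r → ℤ) : ℤ :=
  ∑ σ : Equiv.Perm (Fin r), ((Equiv.Perm.sign σ : ℤˣ) : ℤ) *
    (Npos t (fun i => ν i - ((i : ℕ) : ℤ) + ((σ i : ℕ) : ℤ)) : ℤ)

theorem JT_succ (t : ℕ) {r : ℕ} (ν : Fin r → ℤ) :
    JT (t + 1) ν = ∑ i, JT t (fun a => ν a - if a = i then 1 else 0) := by
  unfold JT
  rw [Finset.sum_comm]
  refine Finset.sum_congr rfl fun σ _ => ?_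
  rw [Npos_succ, Nat.cast_sum, Finset.mul_sum]
  refine Finset.sum_congr rfl fun i _ => ?_
  congr 3
  funext a
  ring

theorem alt_sum_zero {r : ℕ} (i j : Fin r) (hij : i ≠ j) (F : Equiv.Perm (Fin r) → ℤ)
    (h : ∀ σ, F (σ * Equiv.swap i j) = F σ) :
    ∑ σ : Equiv.Perm (Fin r), ((Equiv.Perm.sign σ : ℤˣ) : ℤ) * F σ = 0 := by
  have : ∑ σ : Equiv.Perm (Fin r), ((Equiv.Perm.sign σ : ℤˣ) : ℤ) * F σ =
      - ∑ σ : Equiv.Perm (Fin r), ((Equiv.Perm.sign σ : ℤˣ) : ℤ) * F σ := by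
    conv_lhs => rw [← Equiv.sum_comp (Equiv.mulRight (Equiv.swap i j))]
    rw [← Finset.sum_neg_distrib]
    refine Finset.sum_congr rfl fun σ _ => ?_
    simp [h, Equiv.Perm.sign_swap hij]
  linarith

theorem JT_eq_zero (t : ℕ) {r : ℕ} (ν : Fin r → ℤ) (i j : Fin r) (hij : i ≠ j)
    (h : ν i - ((i : ℕ) : ℤ) = ν j - ((j : ℕ) : ℤ)) : JT t ν = 0 := by
  unfold JT
  refine alt_sum_zero i j hij _ fun σ => ?_
  congr 1
  rw [← Npos_comp t _ (Equiv.swap i j)]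
  congr 1
  funext a
  simp only [Equiv.Perm.mul_apply, Equiv.swap_apply_self]
  rcases eq_or_ne a i with rfl | h1
  · simp [h]
  rcases eq_or_ne a j with rfl | h2
  · simp [h]
  rw [Equiv.swap_apply_of_ne_of_ne h1 h2]

theorem JT_neg (t : ℕ) {r : ℕ} (ν : Fin r → ℤ) (i : Fin r)
    (h : ν i - ((i : ℕ) : ℤ) + ((r : ℤ) - 1) < 0) : JT t ν = 0 := by
  unfold JT
  refine Finset.sum_eq_zero fun σ _ => ?_
  rw [Npos_neg t _ i]
  · simp
  · have := (σ i).2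
    omega

theorem perm_eq_one_of_le {r : ℕ} (σ : Equiv.Perm (Fin r)) (h : ∀ i, i ≤ σ i) : σ = 1 := by
  by_contra hne
  have hlt : ∑ i, ((i : Fin r) : ℕ) < ∑ i, ((σ i : Fin r) : ℕ) := by
    obtain ⟨i, hi⟩ : ∃ i, σ i ≠ i := by
      by_contra! h2
      exact hne (Equiv.ext h2)
    refine Finset.sum_lt_sum (fun i _ => h i) ⟨i, Finset.mem_univ _, ?_⟩
    exact lt_of_le_of_ne (h i) (fun h3 => hi (Fin.ext h3.symm))
  rw [Equiv.sum_comp σ (fun i => (i : ℕ))] at hlt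
  exact lt_irrefl _ hlt

theorem fSYTRow_onerow (c : ℕ) : ∀ μ : YoungDiagram, μ.card = c → μ.rowLen 1 = 0 →
    fSYTRow μ c = 1 := by
  induction c with
  | zero =>
    intro μ hμ h1
    have hmem : ∀ p, p ∉ μ := by
      intro p hp
      have : μ.cells = ∅ := Finset.card_eq_zero.1 hμ
      have h2 : p ∈ μ.cells := hp
      rw [this] at h2
      simp at h2
    unfold fSYTRow
    rw [Nat.card_eq_one_iff_unique]
    constructor
    · constructor
      rintro ⟨Q, _⟩ ⟨Q', _⟩
      apply Subtype.ext
      apply SYT.ext_entry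
      funext a b
      change Q.entry a b = Q'.entry a b
      rw [Q.entry_eq_zero _ _ (hmem _), Q'.entry_eq_zero _ _ (hmem _)]
    · refine ⟨⟨fun _ _ => 0, fun _ _ _ => rfl, fun _ _ _ _ h => absurd h (hmem _),
        fun _ _ _ _ h => absurd h (hmem _), ?_⟩, fun k hk1 hk2 => absurd hk1 (by omega)⟩
      have : μ.cells = ∅ := Finset.card_eq_zero.1 hμ
      rw [this, hμ]
      simp
  | succ c ih =>
    intro μ hμ h1
    have hrow : ∀ a b, (a, b) ∈ μ → a = 0 := by
      intro a b hab
      rw [YoungDiagram.mem_iff_lt_rowLen] at hab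
      by_contra h0
      have := μ.rowLen_anti 1 a (by omega)
      omega
    have hall : ∀ m, m ≤ μ.card → ∀ Q : SYT μ, ∀ k, 1 ≤ k → k ≤ m →
        ∃ j, (0, j) ∈ μ ∧ Q.entry 0 j = k := by
      intro m hm Q k hk1 hk2
      obtain ⟨⟨a, b⟩, hp, he⟩ := Q.exists_entry k hk1 (by omega)
      obtain rfl := hrow a b hp
      exact ⟨b, hp, he⟩
    have hpos : 0 < μ.rowLen 0 := by
      by_contra h0
      have hne : μ.cells.Nonempty := by
        rw [← Finset.card_pos]; change 0 < μ.card; omega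
      obtain ⟨⟨a, b⟩, hp⟩ := hne
      have hp' : (a, b) ∈ μ := hp
      obtain rfl := hrow a b hp'
      rw [YoungDiagram.mem_iff_lt_rowLen] at hp'
      omega
    have e1 : fSYTRow μ (c + 1) = fSYTRow μ c := by
      unfold fSYTRow
      refine Nat.card_congr (Equiv.subtypeEquivRight fun Q => ?_)
      exact ⟨fun _ => hall c (by omega) Q, fun _ => hall (c + 1) (by omega) Q⟩
    rw [e1, fSYTRow_rec μ c 1 h1 (by omega)]
    have hc : μ.rowLen (0 + 1) < μ.rowLen 0 := by rw [zero_add]; omega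
    rw [Fin.sum_univ_one]
    change (if μ.rowLen (0 + 1) < μ.rowLen 0 then fSYTRow (rmC μ 0) c else 0) = 1
    rw [if_pos hc]
    have := card_rmC hc
    apply ih
    · omega
    · rw [rowLen_rmC hc, if_neg (by omega)]; exact h1

theorem JT_zero (μ : YoungDiagram) (r : ℕ) (hr : μ.rowLen r = 0) :
    JT 0 (fun i : Fin r => ((μ.rowLen (i : ℕ) : ℕ) : ℤ)) = fSYTRow μ μ.card := by
  rcases Nat.eq_zero_or_pos (μ.rowLen 1) with h1 | h1
  · rw [fSYTRow_onerow _ μ rfl h1]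
    unfold JT
    rw [Finset.sum_eq_single 1]
    · rw [Npos_zero, if_pos]
      · simp
      · intro i; simp
    · intro σ _ hσ
      rw [Npos_zero, if_neg]
      · simp
      · intro h
        apply hσ
        apply perm_eq_one_of_le
        intro i
        have h2 : (0 : ℤ) ≤ ((μ.rowLen (i : ℕ) : ℕ) : ℤ) - ((i : ℕ) : ℤ) + ((σ i : ℕ) : ℤ) := h i
        rcases Nat.eq_zero_or_pos (i : ℕ) with h0 | h0
        · rw [Fin.le_def]; omega
        · have := μ.rowLen_anti 1 i (by omega)
          rw [Fin.le_def]
          omega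
    · simp
  · have hr2 : 2 ≤ r := by
      by_contra h
      have := μ.rowLen_anti r 1 (by omega)
      omega
    have e0 : fSYTRow μ μ.card = 0 := by
      unfold fSYTRow
      have : IsEmpty {Q : SYT μ // ∀ k, 1 ≤ k → k ≤ μ.card → ∃ j, (0, j) ∈ μ ∧ Q.entry 0 j = k} := by
        constructor
        rintro ⟨Q, hQ⟩
        have hm : (1, 0) ∈ μ := by rw [YoungDiagram.mem_iff_lt_rowLen]; exact h1
        obtain ⟨hk1, hk2⟩ := Q.entry_mem 1 0 hm
        obtain ⟨j, hj, he⟩ := hQ _ hk1 hk2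
        have := Q.entry_inj (0, j) (1, 0) hj hm he
        simp at this
      exact Nat.card_of_isEmpty
    rw [e0]
    unfold JT
    have hne : (⟨0, by omega⟩ : Fin r) ≠ ⟨1, by omega⟩ := by simp
    refine (alt_sum_zero (⟨0, by omega⟩ : Fin r) ⟨1, by omega⟩ hne _ fun σ => ?_).trans (by simp)
    congr 1
    rw [Npos_zero, Npos_zero]
    congr 1
    apply propext
    refine forall_congr' fun a => ?_
    have h01 := μ.rowLen_anti 0 1 (by omega)
    rcases eq_or_ne a ⟨0, by omega⟩ with rfl | ha
    · constructor <;> intro _ <;> simp only <;> push_cast <;> omega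
    rcases eq_or_ne a ⟨1, by omega⟩ with rfl | hb
    · constructor <;> intro _ <;> simp only <;> push_cast <;> omega
    rw [Equiv.Perm.mul_apply, Equiv.swap_apply_of_ne_of_ne ha hb]

theorem JT_eq (r m : ℕ) (t : ℕ) : ∀ μ : YoungDiagram, μ.rowLen r = 0 → μ.card = m + t →
    JT t (fun i : Fin r => ((μ.rowLen (i : ℕ) : ℕ) : ℤ)) = fSYTRow μ m := by
  induction t with
  | zero =>
    intro μ hr hc
    rw [JT_zero μ r hr, hc, add_zero]
  | succ t ih =>
    intro μ hr hc
    rw [JT_succ, fSYTRow_rec μ m r hr (by omega), Nat.cast_sum]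
    refine Finset.sum_congr rfl fun i _ => ?_
    split_ifs with h
    · have hcard := card_rmC h
      rw [← ih (rmC μ i) (by rw [rowLen_rmC h, if_neg (by omega)]; exact hr) (by omega)]
      congr 1
      funext a
      rw [rowLen_rmC h]
      by_cases hai : a = i
      · subst hai
        rw [if_pos rfl, if_pos rfl]
        omega
      · rw [if_neg hai, if_neg (fun h => hai (Fin.ext h))]
        omega
    · have hle := μ.rowLen_anti i (i + 1) (by omega)
      rcases Nat.lt_or_ge ((i : ℕ) + 1) r with h2 | h2
      · refine (JT_eq_zero t _ i ⟨i + 1, h2⟩ ?_ ?_).trans (by simp)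
        · intro h3
          have := congrArg Fin.val h3
          simp at this
        · rw [if_pos rfl, if_neg]
          · push_cast
            omega
          · intro h3
            have := congrArg Fin.val h3
            simp at this
      · refine (JT_neg t _ i ?_).trans (by simp)
        rw [if_pos rfl]
        have hi : (i : ℕ) + 1 = r := by omega
        rw [hi] at h
        omega

theorem sum_rowLen (μ : YoungDiagram) (r : ℕ) (hr : μ.rowLen r = 0) :
    ∑ i : Fin r, μ.rowLen i = μ.card := by
  rw [Fin.sum_univ_eq_sum_range (fun i => μ.rowLen i) r]
  have : μ.card = μ.cells.card := rfl
  rw [this, Finset.card_eq_sum_card_fiberwise (f := Prod.fst) (t := Finset.range r)]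
  · refine Finset.sum_congr rfl fun i _ => ?_
    rw [YoungDiagram.rowLen_eq_card]
    rfl
  · rintro ⟨a, b⟩ hab
    have hab' : (a, b) ∈ μ := hab
    rw [YoungDiagram.mem_iff_lt_rowLen] at hab'
    simp only [Finset.coe_range, Set.mem_Iio]
    by_contra h
    have := μ.rowLen_anti r a (by omega)
    omega

theorem mult_chi (n : ℕ) (μ : YoungDiagram) (hμ : μ.card = n) (t : ℕ) (ht : t ≤ n) :
    ∑ g : Equiv.Perm (Fin n), (fixW n t g : ℤ) * chi n μ g⁻¹ =
      (fSYTRow μ (n - t) : ℤ) * (n.factorial : ℤ) := by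
  have hr : μ.rowLen μ.rowLens.length = 0 := by
    rw [YoungDiagram.length_rowLens]
    by_contra h
    have : (μ.colLen 0, 0) ∈ μ := by
      rw [YoungDiagram.mem_iff_lt_rowLen]; omega
    rw [YoungDiagram.mem_iff_lt_colLen] at this
    omega
  rw [← JT_eq μ.rowLens.length (n - t) t μ hr (by omega)]
  unfold chi JT
  simp only [Finset.mul_sum]
  rw [Finset.sum_comm, Finset.sum_mul]
  refine Finset.sum_congr rfl fun σ _ => ?_
  have hc : ∑ i : Fin μ.rowLens.length,
      (((μ.rowLen (i : ℕ) : ℕ) : ℤ) - ((i : ℕ) : ℤ) + ((σ i : ℕ) : ℤ)) = n := by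
    rw [Finset.sum_add_distrib, Finset.sum_sub_distrib,
      Equiv.sum_comp σ (fun i => ((i : ℕ) : ℤ)), ← Nat.cast_sum, sum_rowLen μ _ hr, hμ]
    ring
  have := burnside_YX (n := n) (t := t) _ hc
  have h2 := congrArg (Nat.cast : ℕ → ℤ) this
  push_cast at h2
  rw [mul_assoc, ← h2, Finset.mul_sum]
  refine Finset.sum_congr rfl fun g _ => ?_
  ring


/-! #### facts about `sElt` -/

theorem sElt_zero (n : ℕ) (S : Finset ℕ) : sElt n S 0 = 0 := by
  unfold sElt; rw [if_pos rfl]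

theorem sElt_mid (n : ℕ) (S : Finset ℕ) (j : ℕ) (h1 : 1 ≤ j) (h2 : j ≤ S.card) :
    sElt n S j = (S.sort (· ≤ ·))[j - 1]'(by rw [Finset.length_sort]; omega) := by
  unfold sElt
  rw [if_neg (by omega), if_pos h2, List.getD_eq_getElem]

theorem sElt_mem (n : ℕ) (S : Finset ℕ) (j : ℕ) (h1 : 1 ≤ j) (h2 : j ≤ S.card) :
    sElt n S j ∈ S := by
  rw [sElt_mid n S j h1 h2]
  exact (Finset.mem_sort (· ≤ ·)).1 (List.getElem_mem _)

theorem exists_sElt (n : ℕ) (S : Finset ℕ) (x : ℕ) (hx : x ∈ insert n S) :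
    ∃ j, 1 ≤ j ∧ j ≤ S.card + 1 ∧ sElt n S j = x := by
  rcases Finset.mem_insert.1 hx with rfl | hx
  · exact ⟨S.card + 1, by omega, le_rfl, sElt_of_gt _ _ _ (by omega)⟩
  · obtain ⟨i, hi, he⟩ := List.getElem_of_mem ((Finset.mem_sort (· ≤ ·)).2 hx)
    have hi' := hi
    rw [Finset.length_sort] at hi'
    refine ⟨i + 1, by omega, by omega, ?_⟩
    rw [sElt_mid n S (i + 1) (by omega) (by omega)]
    simpa using he

theorem sElt_lt (n : ℕ) (hn : 0 < n) (S : Finset ℕ) (hS : S ⊆ Finset.Icc 1 (n - 1)) (i j : ℕ)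
    (hij : i < j) (hj : j ≤ S.card + 1) : sElt n S i < sElt n S j := by
  rcases Nat.eq_zero_or_pos i with rfl | hi
  · rw [sElt_zero]
    rcases Nat.lt_or_ge S.card j with h | h
    · rw [sElt_of_gt _ _ _ h]; exact hn
    · have := Finset.mem_Icc.1 (hS (sElt_mem n S j (by omega) h)); omega
  · rcases Nat.lt_or_ge S.card j with h | h
    · rw [sElt_of_gt _ _ _ h]
      have := Finset.mem_Icc.1 (hS (sElt_mem n S i (by omega) (by omega))); omega
    · rw [sElt_mid n S i hi (by omega), sElt_mid n S j (by omega) h]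
      have := (Finset.sortedLT_sort S).strictMono_get
      exact this (show (⟨i - 1, by rw [Finset.length_sort]; omega⟩ : Fin _) <
        ⟨j - 1, by rw [Finset.length_sort]; omega⟩ by
          rw [Fin.lt_def]; change i - 1 < j - 1; omega)

theorem sElt_le (n : ℕ) (hn : 0 < n) (S : Finset ℕ) (hS : S ⊆ Finset.Icc 1 (n - 1)) (i j : ℕ)
    (hij : i ≤ j) (hj : j ≤ S.card + 1) : sElt n S i ≤ sElt n S j := by
  rcases hij.eq_or_lt with rfl | h
  · exact le_rfl
  · exact (sElt_lt n hn S hS i j h hj).le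

/-! #### descents of permutations agreeing with `wS` -/

theorem descentSet_eq_iff {n : ℕ} (S : Finset ℕ) (wS : Equiv.Perm (Fin n))
    (hwS : descentSet wS = S)
    (hsep : ∀ x y : Fin n, ∀ s ∈ S, (x : ℕ) < s → s ≤ (y : ℕ) → wS y < wS x)
    (s : ℕ) (hs : s ∈ S ∨ s = n ∨ s = 0) (w : Equiv.Perm (Fin n))
    (hw : ∀ x : Fin n, s ≤ (x : ℕ) → w x = wS x) :
    descentSet w = S ↔ (descentSet w).filter (· < s) = S.filter (· < s) := by
  constructor
  · intro h; rw [h]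
  · intro h
    ext i
    rcases lt_trichotomy i s with hi | hi | hi
    · have := Finset.ext_iff.1 h i
      simpa [hi] using this
    · subst hi
      rcases hs with hs | hs | hs
      · simp only [hs, iff_true]
        have hs' := hs
        rw [← hwS, mem_descentSet'] at hs'
        obtain ⟨h1, h2, -⟩ := hs'
        rw [mem_descentSet']
        refine ⟨h1, h2, ?_⟩
        rw [hw ⟨i, h2⟩ le_rfl]
        obtain ⟨y, hy⟩ := wS.surjective (w ⟨i - 1, by omega⟩)
        rw [← hy]
        apply hsep _ _ i hs _ le_rfl
        by_contra hy2
        rw [← hw y (by omega)] at hy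
        have := congrArg Fin.val (w.injective hy)
        simp only at this
        omega
      · rw [← hwS, mem_descentSet', mem_descentSet']
        constructor
        · rintro ⟨_, h2, _⟩; omega
        · rintro ⟨_, h2, _⟩; omega
      · rw [← hwS, mem_descentSet', mem_descentSet']
        constructor
        · rintro ⟨_, h2, _⟩; omega
        · rintro ⟨_, h2, _⟩; omega
    · rw [← hwS, mem_descentSet', mem_descentSet']
      refine exists_congr fun h1 => exists_congr fun h2 => ?_
      rw [hw _ (by simp only; omega), hw _ (by simp only; omega)]

theorem permApp_cond {n : ℕ} (w wS : Equiv.Perm (Fin n)) (s : ℕ) :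
    (∀ x, s < x → x ≤ n → permApp w x = permApp wS x) ↔
      ∀ x : Fin n, s ≤ (x : ℕ) → w x = wS x := by
  constructor
  · intro h x hx
    have := h (x + 1) (by omega) (by omega)
    unfold permApp at this
    rw [dif_pos (by simp), dif_pos (by simp)] at this
    apply Fin.ext
    simpa using this
  · intro h x hx hxn
    unfold permApp
    rw [dif_pos (by omega), dif_pos (by omega), h _ (by simp only; omega)]

/-! #### the recursion -/

noncomputable def BB (n : ℕ) (μ : YoungDiagram) (A : Finset ℕ) : ℤ :=
  ∑ g : Equiv.Perm (Fin n), injBeta n A g * chi n μ g⁻¹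

theorem BB_eq (n : ℕ) (μ : YoungDiagram) (A : Finset ℕ) :
    BB n μ A = ∑ T ∈ A.powerset, (-1 : ℤ) ^ (A.card - T.card) *
      ∑ g : Equiv.Perm (Fin n), injAlpha n T g * chi n μ g⁻¹ := by
  unfold BB injBeta gBeta
  simp only [Finset.sum_mul, Finset.mul_sum]
  rw [Finset.sum_comm]
  refine Finset.sum_congr rfl fun T _ => Finset.sum_congr rfl fun g _ => ?_
  rw [mul_assoc]
  rfl

theorem fixW_zero (n : ℕ) (g : Equiv.Perm (Fin n)) : fixW n 0 g = 1 := by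
  rw [fixW_eq, Nat.card_eq_one_iff_unique]
  constructor
  · constructor
    rintro ⟨a, _⟩ ⟨b, _⟩
    apply Subtype.ext
    ext x
    exact x.elim0
  · exact ⟨⟨fun x => x.elim0, fun x => x.elim0⟩, fun x => x.elim0⟩

theorem BB_empty (n : ℕ) (μ : YoungDiagram) (hμ : μ.card = n) :
    BB n μ ∅ = (fSYTRow μ n : ℤ) * (n.factorial : ℤ) := by
  have := mult_chi n μ hμ 0 (by omega)
  simp only [fixW_zero, Nat.sub_zero] at this
  rw [BB_eq, ← this]
  simp [injAlpha_empty]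

theorem BB_insert (n : ℕ) (μ : YoungDiagram) (hμ : μ.card = n) (t : ℕ) (A : Finset ℕ)
    (h : insert t A ⊆ Finset.Icc 1 n) (hA : ∀ x ∈ A, x < t) (w0 : Equiv.Perm (Fin n)) :
    BB n μ (insert t A) = (Nat.card {w : Equiv.Perm (Fin n) //
        (∀ x : Fin n, t ≤ (x : ℕ) → w x = w0 x) ∧ (descentSet w).filter (· < t) = A} : ℤ) *
      (fSYTRow μ (n - t) : ℤ) * (n.factorial : ℤ) - BB n μ A := by
  have htA : t ∉ A := fun h => lt_irrefl _ (hA t h)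
  have htn : t ≤ n := (Finset.mem_Icc.1 (h (Finset.mem_insert_self _ _))).2
  rw [← sum_aNum w0 t htn A (fun x hx => (hA x hx).le), BB_eq, BB_eq, Finset.sum_powerset_insert htA,
    Finset.card_insert_of_notMem htA, sub_eq_neg_add, mul_assoc, ← mult_chi n μ hμ t htn,
    Finset.sum_mul, ← Finset.sum_neg_distrib]
  congr 1
  · refine Finset.sum_congr rfl fun T hT => ?_
    have := Finset.card_le_card (Finset.mem_powerset.1 hT)
    rw [Nat.sub_add_comm this, pow_succ]
    ring
  · refine Finset.sum_congr rfl fun T hT => ?_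
    have hT' := Finset.mem_powerset.1 hT
    rw [Finset.card_insert_of_notMem (fun h => htA (hT' h)), Nat.add_sub_add_right, mul_assoc]
    congr 1
    rw [Finset.mul_sum]
    refine Finset.sum_congr rfl fun g _ => ?_
    rw [injAlpha_insert t T ((Finset.insert_subset_insert t hT').trans h)
      (fun x hx => hA x (hT' hx))]
    ring

/-- the condition in the definition of `tau`, at `s` -/
def condS {n : ℕ} {μ : YoungDiagram} (wS : Equiv.Perm (Fin n)) (s : ℕ)
    (p : Equiv.Perm (Fin n) × SYT μ) : Prop :=
  (∀ x, s < x → x ≤ n → permApp p.1 x = permApp wS x) ∧ (∀ d ∈ p.2.des, n - s ≤ d)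

noncomputable def XX {n : ℕ} (μ : YoungDiagram) (S : Finset ℕ) (wS : Equiv.Perm (Fin n)) (s : ℕ) : ℕ :=
  Nat.card {p : Equiv.Perm (Fin n) × SYT μ // descentSet p.1 = S ∧ condS wS s p}

theorem XX_eq {n : ℕ} (μ : YoungDiagram) (hμ : μ.card = n) (S : Finset ℕ)
    (wS : Equiv.Perm (Fin n)) (hwS : descentSet wS = S)
    (hsep : ∀ x y : Fin n, ∀ s ∈ S, (x : ℕ) < s → s ≤ (y : ℕ) → wS y < wS x)
    (s : ℕ) (hs : s ∈ S ∨ s = n ∨ s = 0) :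
    XX μ S wS s = Nat.card {w : Equiv.Perm (Fin n) //
        (∀ x : Fin n, s ≤ (x : ℕ) → w x = wS x) ∧
          (descentSet w).filter (· < s) = S.filter (· < s)} * fSYTRow μ (n - s) := by
  unfold XX
  have e : fSYTRow μ (n - s) = Nat.card {Q : SYT μ // RowC (n - s) Q} := rfl
  rw [e, ← Nat.card_prod]
  refine Nat.card_congr ?_
  refine Equiv.trans (Equiv.subtypeEquivRight fun p => ?_) Equiv.subtypeProdEquivProd
  unfold condS
  rw [permApp_cond, RowC_iff _ (by omega)]
  constructor
  · rintro ⟨h1, h2, h3⟩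
    exact ⟨⟨h2, (descentSet_eq_iff S wS hwS hsep s hs p.1 h2).1 h1⟩, h3⟩
  · rintro ⟨⟨h2, h1⟩, h3⟩
    exact ⟨(descentSet_eq_iff S wS hwS hsep s hs p.1 h2).2 h1, h2, h3⟩

theorem BB_formula {n : ℕ} (hn : 0 < n) (μ : YoungDiagram) (hμ : μ.card = n) (S : Finset ℕ)
    (hS : S ⊆ Finset.Icc 1 (n - 1))
    (wS : Equiv.Perm (Fin n)) (hwS : descentSet wS = S)
    (hsep : ∀ x y : Fin n, ∀ s ∈ S, (x : ℕ) < s → s ≤ (y : ℕ) → wS y < wS x)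
    (j : ℕ) (hj : j ≤ S.card + 1) :
    BB n μ ((insert n S).filter (· ≤ sElt n S j)) =
      (∑ i ∈ Finset.range (j + 1), (-1 : ℤ) ^ i * (XX μ S wS (sElt n S (j - i)) : ℤ)) *
        (n.factorial : ℤ) := by
  have hins : insert n S ⊆ Finset.Icc 1 n := by
    intro x hx
    rw [Finset.mem_Icc]
    rcases Finset.mem_insert.1 hx with rfl | hx
    · omega
    · have := Finset.mem_Icc.1 (hS hx); omega
  induction j with
  | zero =>
    have e1 : (insert n S).filter (· ≤ sElt n S 0) = ∅ := by
      rw [sElt_zero]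
      refine Finset.filter_eq_empty_iff.2 fun x hx => ?_
      have := Finset.mem_Icc.1 (hins hx); omega
    rw [e1, BB_empty n μ hμ]
    simp only [zero_add, Finset.range_one, Finset.sum_singleton, pow_zero, one_mul, Nat.sub_zero]
    rw [sElt_zero, XX_eq μ hμ S wS hwS hsep 0 (by simp)]
    have : Nat.card {w : Equiv.Perm (Fin n) // (∀ x : Fin n, 0 ≤ (x : ℕ) → w x = wS x) ∧
          (descentSet w).filter (· < 0) = S.filter (· < 0)} = 1 := by
      rw [Nat.card_eq_one_iff_unique]
      constructor
      · constructor
        rintro ⟨a, ha, _⟩ ⟨b, hb, _⟩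
        apply Subtype.ext
        ext x
        rw [ha x (by omega), hb x (by omega)]
      · exact ⟨⟨wS, fun _ _ => rfl, by rw [hwS]⟩⟩
    rw [this]
    simp
  | succ j ih =>
    have hlt := sElt_lt n hn S hS j (j + 1) (by omega) hj
    have hmem : sElt n S (j + 1) ∈ insert n S := by
      rcases Nat.lt_or_ge S.card (j + 1) with h | h
      · rw [sElt_of_gt _ _ _ h]; exact Finset.mem_insert_self _ _
      · exact Finset.mem_insert_of_mem (sElt_mem n S _ (by omega) h)
    have hkey : ∀ x ∈ insert n S, x < sElt n S (j + 1) → x ≤ sElt n S j := by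
      intro x hx hxl
      obtain ⟨i, hi1, hi2, rfl⟩ := exists_sElt n S x hx
      apply sElt_le n hn S hS
      · by_contra h
        have := sElt_le n hn S hS (j + 1) i (by omega) hi2
        omega
      · omega
    have e1 : (insert n S).filter (· ≤ sElt n S (j + 1)) =
        insert (sElt n S (j + 1)) ((insert n S).filter (· ≤ sElt n S j)) := by
      ext x
      simp only [Finset.mem_filter, Finset.mem_insert]
      constructor
      · rintro ⟨h1, h2⟩
        rcases h2.eq_or_lt with h3 | h3
        · exact Or.inl h3
        · exact Or.inr ⟨h1, hkey x (Finset.mem_insert.2 h1) h3⟩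
      · rintro (rfl | ⟨h1, h2⟩)
        · exact ⟨Finset.mem_insert.1 hmem, le_rfl⟩
        · exact ⟨h1, by omega⟩
    have e2 : (insert n S).filter (· ≤ sElt n S j) = S.filter (· < sElt n S (j + 1)) := by
      ext x
      simp only [Finset.mem_filter]
      constructor
      · rintro ⟨h1, h2⟩
        refine ⟨?_, by omega⟩
        rcases Finset.mem_insert.1 h1 with rfl | h1
        · have := (Finset.mem_Icc.1 (hins hmem)).2; omega
        · exact h1
      · rintro ⟨h1, h2⟩
        exact ⟨Finset.mem_insert_of_mem h1, hkey x (Finset.mem_insert_of_mem h1) h2⟩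
    have hsub : (insert n S).filter (· ≤ sElt n S (j + 1)) ⊆ Finset.Icc 1 n :=
      (Finset.filter_subset _ _).trans hins
    rw [e1] at hsub ⊢
    rw [BB_insert n μ hμ _ _ hsub
      (fun x hx => lt_of_le_of_lt (Finset.mem_filter.1 hx).2 hlt) wS, ih (by omega), e2,
      Finset.sum_range_succ' _ (j + 1), Nat.sub_zero, XX_eq μ hμ S wS hwS hsep (sElt n S (j + 1))]
    · push_cast
      have e3 : ∑ i ∈ Finset.range (j + 1), (-1 : ℤ) ^ (i + 1) *
            (XX μ S wS (sElt n S (j - i)) : ℤ) =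
          - ∑ i ∈ Finset.range (j + 1), (-1 : ℤ) ^ i * (XX μ S wS (sElt n S (j - i)) : ℤ) := by
        rw [← Finset.sum_neg_distrib]
        refine Finset.sum_congr rfl fun i _ => ?_
        rw [pow_succ]
        ring
      rw [e3]
      ring
    · rcases Finset.mem_insert.1 hmem with h | h
      · exact Or.inr (Or.inl h)
      · exact Or.inl h

theorem condS_mono {n : ℕ} {μ : YoungDiagram} (wS : Equiv.Perm (Fin n)) (s s' : ℕ) (h : s ≤ s')
    (p : Equiv.Perm (Fin n) × SYT μ) (hp : condS wS s p) : condS wS s' p := by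
  refine ⟨fun x hx hxn => hp.1 x (by omega) hxn, fun d hd => ?_⟩
  have := hp.2 d hd
  omega

theorem alt_tau {n : ℕ} (hn : 0 < n) {μ : YoungDiagram} (S : Finset ℕ)
    (hS : S ⊆ Finset.Icc 1 (n - 1)) (wS : Equiv.Perm (Fin n))
    (p : Equiv.Perm (Fin n) × SYT μ) :
    (∑ i ∈ Finset.range (S.card + 2), (-1 : ℤ) ^ i *
      if condS wS (sElt n S (S.card + 1 - i)) p then 1 else 0) =
      if Even (tau n S wS p.1 p.2) then 1 else 0 := by
  have hF : (Finset.range (S.card + 2)).filter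
      (fun i => condS wS (sElt n S (S.card + 1 - i)) p) =
      Finset.range (tau n S wS p.1 p.2 + 1) := by
    have hmax : tau n S wS p.1 p.2 ∈ Finset.range (S.card + 2) ∧
        condS wS (sElt n S (S.card + 1 - tau n S wS p.1 p.2)) p := by
      unfold tau
      exact Finset.mem_filter.1 (Finset.max'_mem _ _)
    ext i
    constructor
    · intro hi
      have : i ≤ tau n S wS p.1 p.2 := by
        unfold tau
        apply Finset.le_max'
        rw [Finset.mem_filter]
        exact Finset.mem_filter.1 hi
      rw [Finset.mem_range]; omega
    · intro hi
      rw [Finset.mem_range] at hi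
      rw [Finset.mem_range] at hmax
      rw [Finset.mem_filter, Finset.mem_range]
      refine ⟨by omega, condS_mono wS _ _ ?_ p hmax.2⟩
      exact sElt_le n hn S hS _ _ (by omega) (by omega)
  simp only [mul_ite, mul_one, mul_zero]
  rw [← Finset.sum_filter, hF, neg_one_geom_sum]
  simp only [Nat.even_add_one]
  split_ifs <;> simp_all

theorem card_even {n : ℕ} (hn : 0 < n) (μ : YoungDiagram) (S : Finset ℕ)
    (hS : S ⊆ Finset.Icc 1 (n - 1)) (wS : Equiv.Perm (Fin n)) :
    (∑ i ∈ Finset.range (S.card + 2), (-1 : ℤ) ^ i *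
      (XX μ S wS (sElt n S (S.card + 1 - i)) : ℤ)) =
    (Nat.card {p : Equiv.Perm (Fin n) × SYT μ //
          descentSet p.1 = S ∧ Even (tau n S wS p.1 p.2)} : ℤ) := by
  have : Fintype (SYT μ) := Fintype.ofFinite _
  have hc : ∀ P : Equiv.Perm (Fin n) × SYT μ → Prop,
      (Nat.card {p : Equiv.Perm (Fin n) × SYT μ // descentSet p.1 = S ∧ P p} : ℤ) =
      ∑ p ∈ Finset.univ.filter (fun p : Equiv.Perm (Fin n) × SYT μ => descentSet p.1 = S),
        if P p then 1 else 0 := by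
    intro P
    rw [Nat.card_eq_fintype_card, Fintype.card_subtype, ← Finset.filter_filter,
      Finset.card_filter]
    push_cast
    rfl
  unfold XX
  simp only [hc, Finset.mul_sum]
  rw [Finset.sum_comm]
  refine Finset.sum_congr rfl fun p _ => ?_
  rw [alt_tau hn S hS wS p]
  congr

/-- **Theorem 1.2(b)**: `b_λ(S ∪ {n})` equals the number of pairs `(w,Q)` with `w ∈ 𝔖_n`
of descent set `S` and `Q` a standard Young tableau of shape `λ` with `τ(w,Q)` even. -/
theorem statement2 (n : ℕ) (hn : 0 < n) (μ : YoungDiagram) (hμ : μ.card = n)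
    (S : Finset ℕ) (hS : S ⊆ Finset.Icc 1 (n - 1))
    (wS : Equiv.Perm (Fin n)) (hwS : descentSet wS = S)
    (hwSmax : ∀ v : Equiv.Perm (Fin n), descentSet v = S → invCount v ≤ invCount wS) :
    (∑ g : Equiv.Perm (Fin n), injBeta n (insert n S) g * chi n μ g⁻¹) =
      (Nat.card {p : Equiv.Perm (Fin n) × SYT μ //
          descentSet p.1 = S ∧ Even (tau n S wS p.1 p.2)} : ℤ) * (n.factorial : ℤ) := by
  have h := BB_formula hn μ hμ S hS wS hwS (wS_sep n S hS wS hwS hwSmax) (S.card + 1) le_rfl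
  have e : (insert n S).filter (· ≤ sElt n S (S.card + 1)) = insert n S := by
    rw [sElt_of_gt _ _ _ (Nat.lt_succ_self _)]
    refine Finset.filter_true_of_mem fun x hx => ?_
    rcases Finset.mem_insert.1 hx with rfl | hx
    · exact le_rfl
    · have := Finset.mem_Icc.1 (hS hx); omega
  rw [e, card_even hn μ S hS wS] at h
  exact h
end

section
/- Let P be a finite graded poset of rank n+1 with minimum 0̂ and maximum 1̂ such that P ∖ {1̂} is simplicial, and let G be a group of automorphisms of P whose action is good. Then for every S = {s_1 < s_2 < ⋯ < s_k} ⊆ {1,…,n}, β_P(S) = (−1)^k · 1_G + Σ_{i=1}^k (−1)^{k−i} b_{s_i}({s_1,…,s_{i−1}}) · α_P({s_i}), where 1_G is the trivial representation of G and b_m(T) denotes the number of permutations in 𝔖_m with descent set T. -/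
open scoped Classical

namespace Stmt3

/-- Chains with rank set `U`, all of whose elements satisfy `q`. -/
def Ch {P : Type*} [PartialOrder P] (ρ : P → ℕ) (q : P → Prop) (U : Finset ℕ) :
    Set (Finset P) :=
  {c | IsChain (· ≤ ·) (c : Set P) ∧ c.image ρ = U ∧ ∀ z ∈ c, q z}

/-- Orderings of `A` all of whose descents lie in `U`. -/
def Ls {m : ℕ} (A : Finset (Fin m)) (U : Finset ℕ) : Set (List (Fin m)) :=
  {l | l.Nodup ∧ l.toFinset = A ∧ ∀ i (h : i + 1 < l.length), l[i + 1] < l[i] → i + 1 ∈ U}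

lemma ch_equiv {P : Type*} [PartialOrder P] (ρ : P → ℕ) (hρ : StrictMono ρ) (q : P → Prop)
    (u : ℕ) (U : Finset ℕ) (hU : ∀ a ∈ U, a < u) :
    Nonempty ((Σ y : {y // q y ∧ ρ y = u}, Ch ρ (fun z => q z ∧ z < y.1) U) ≃
      Ch ρ q (insert u U)) := by
  refine ⟨Equiv.ofBijective (fun p => ⟨insert p.1.1 p.2.1, ?_, ?_, ?_⟩) ⟨?_, ?_⟩⟩
  · rw [Finset.coe_insert]
    exact p.2.2.1.insert fun b hb _ => Or.inr (p.2.2.2.2 b hb).2.le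
  · rw [Finset.image_insert, p.2.2.2.1, p.1.2.2]
  · intro z hz
    rcases Finset.mem_insert.1 hz with rfl | hz
    · exact p.1.2.1
    · exact (p.2.2.2.2 z hz).1
  · rintro ⟨⟨y, hy, hyu⟩, ⟨c, hc1, hc2, hc3⟩⟩ ⟨⟨y', hy', hyu'⟩, ⟨c', hc1', hc2', hc3'⟩⟩ h
    have h : insert y c = insert y' c' := congrArg Subtype.val h
    have hyc : ∀ d : Finset P, d.image ρ = U → ∀ z, ρ z = u → z ∉ d := by
      intro d hd z hz hzd
      have := hU (ρ z) (hd ▸ Finset.mem_image_of_mem ρ hzd)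
      omega
    have h1 : y ∈ insert y' c' := h ▸ Finset.mem_insert_self y c
    have h2 : y = y' := (Finset.mem_insert.1 h1).resolve_right (hyc c' hc2' y hyu)
    subst h2
    have h3 : c = c' := by
      rw [← Finset.erase_insert (hyc c hc2 y hyu), h, Finset.erase_insert (hyc c' hc2' y hyu)]
    subst h3
    rfl
  · rintro ⟨c, hc1, hc2, hc3⟩
    have : u ∈ c.image ρ := hc2 ▸ Finset.mem_insert_self u U
    obtain ⟨y, hy, hyu⟩ := Finset.mem_image.1 this
    have key : ∀ z ∈ c, z ≠ y → ρ z ∈ U ∧ z < y := by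
      intro z hz hzy
      have h1 : ρ z ∈ insert u U := hc2 ▸ Finset.mem_image_of_mem ρ hz
      rcases hc1 hz hy hzy with h | h
      · have h2 : z < y := lt_of_le_of_ne h hzy
        have := hρ h2
        refine ⟨(Finset.mem_insert.1 h1).resolve_left (by omega), h2⟩
      · have h2 : y < z := lt_of_le_of_ne h hzy.symm
        have := hρ h2
        rcases Finset.mem_insert.1 h1 with h3 | h3
        · omega
        · have := hU _ h3
          omega
    refine ⟨⟨⟨y, hc3 y hy, hyu⟩, ⟨c.erase y, ?_, ?_, ?_⟩⟩, ?_⟩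
    · exact hc1.mono (by simp)
    · ext a
      constructor
      · intro ha
        obtain ⟨z, hz, rfl⟩ := Finset.mem_image.1 ha
        exact (key z (Finset.mem_of_mem_erase hz) (Finset.ne_of_mem_erase hz)).1
      · intro ha
        have h1 : a ∈ c.image ρ := hc2 ▸ Finset.mem_insert_of_mem ha
        obtain ⟨z, hz, rfl⟩ := Finset.mem_image.1 h1
        refine Finset.mem_image_of_mem _ (Finset.mem_erase.2 ⟨?_, hz⟩)
        rintro rfl
        have := hU _ ha
        omega
    · intro z hz
      have hz' := Finset.mem_of_mem_erase hz
      exact ⟨hc3 z hz', (key z hz' (Finset.ne_of_mem_erase hz)).2⟩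
    · exact Subtype.ext (Finset.insert_erase hy)

lemma sort_unique {m : ℕ} (l : List (Fin m)) (h1 : l.Nodup)
    (h2 : ∀ i (h : i + 1 < l.length), ¬ l[i + 1] < l[i]) :
    l.toFinset.sort (· ≤ ·) = l := by
  have hs : l.Pairwise (· ≤ ·) := by
    rw [← List.isChain_iff_pairwise, List.isChain_iff_getElem]
    intro i hi
    exact not_lt.1 (h2 i hi)
  exact (List.toFinset_sort (· ≤ ·) h1).2 hs

lemma sort_asc {m : ℕ} (A : Finset (Fin m)) (i : ℕ)
    (h : i + 1 < (A.sort (· ≤ ·)).length) :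
    ¬ (A.sort (· ≤ ·))[i + 1] < (A.sort (· ≤ ·))[i] := by
  have hs := Finset.pairwise_sort A (· ≤ ·)
  rw [← List.isChain_iff_pairwise, List.isChain_iff_getElem] at hs
  exact not_lt.2 (hs i h)

lemma ls_length {m : ℕ} {A : Finset (Fin m)} {U : Finset ℕ} {l : List (Fin m)}
    (h : l ∈ Ls A U) : l.length = A.card := by
  rw [← h.2.1, List.toFinset_card_of_nodup h.1]

lemma ls_equiv {m : ℕ} (A : Finset (Fin m)) (u : ℕ) (U : Finset ℕ) (hU : ∀ a ∈ U, a < u)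
    (hu : u < A.card) :
    Nonempty ((Σ B : {B : Finset (Fin m) // B < A ∧ B.card = u}, Ls B.1 U) ≃
      Ls A (insert u U)) := by
  refine ⟨Equiv.ofBijective (fun p => ⟨p.2.1 ++ (A \ p.1.1).sort (· ≤ ·), ?_, ?_, ?_⟩) ⟨?_, ?_⟩⟩
  · obtain ⟨⟨B, hB, hBu⟩, ⟨l, hl⟩⟩ := p
    refine List.Nodup.append hl.1 (Finset.sort_nodup _ _) ?_
    intro a ha ha'
    rw [Finset.mem_sort, Finset.mem_sdiff, ← hl.2.1, List.mem_toFinset] at ha'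
    exact ha'.2 ha
  · obtain ⟨⟨B, hB, hBu⟩, ⟨l, hl⟩⟩ := p
    rw [List.toFinset_append, hl.2.1, Finset.sort_toFinset]
    exact Finset.union_sdiff_of_subset hB.le
  · obtain ⟨⟨B, hB, hBu⟩, ⟨l, hl⟩⟩ := p
    have hlen : l.length = B.card := ls_length hl
    intro i hi hlt
    dsimp only at hi hlt
    rcases lt_trichotomy (i + 1) u with h | h | h
    · rw [List.getElem_append_left (by omega), List.getElem_append_left (by omega)] at hlt
      exact Finset.mem_insert_of_mem (hl.2.2 i _ hlt)
    · rw [h]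
      exact Finset.mem_insert_self _ _
    · rw [List.getElem_append_right (by omega), List.getElem_append_right (by omega)] at hlt
      have := sort_asc (A \ B) (i - l.length) (by rw [List.length_append] at hi; omega)
      exfalso
      apply this
      convert hlt using 2
      omega
  · rintro ⟨⟨B, hB, hBu⟩, ⟨l, hl⟩⟩ ⟨⟨B', hB', hBu'⟩, ⟨l', hl'⟩⟩ h
    have h := congrArg Subtype.val h
    dsimp only at h
    have h1 := (List.append_inj h (by rw [ls_length hl, ls_length hl', hBu, hBu'])).1
    subst h1
    have h2 : B = B' := hl.2.1.symm.trans hl'.2.1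
    subst h2
    rfl
  · rintro ⟨l, hl⟩
    have hlen := ls_length hl
    have hcard : (l.take u).toFinset.card = u := by
      rw [List.toFinset_card_of_nodup (hl.1.sublist (List.take_sublist _ _)), List.length_take]
      omega
    have hsub : (l.take u).toFinset ⊆ A := by
      rw [← hl.2.1]
      intro a ha
      rw [List.mem_toFinset] at ha ⊢
      exact List.mem_of_mem_take ha
    have hdrop : (A \ (l.take u).toFinset).sort (· ≤ ·) = l.drop u := by
      have h1 : A \ (l.take u).toFinset = (l.drop u).toFinset := by
        have hd : Disjoint (l.take u).toFinset (l.drop u).toFinset := by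
          rw [List.disjoint_toFinset_iff_disjoint]
          exact List.disjoint_take_drop hl.1 le_rfl
        have : A = (l.take u).toFinset ∪ (l.drop u).toFinset := by
          rw [← List.toFinset_append, List.take_append_drop, hl.2.1]
        rw [this, Finset.union_sdiff_cancel_left hd]
      rw [h1]
      apply sort_unique _ (hl.1.sublist (List.drop_sublist _ _))
      intro i hi hlt
      rw [List.getElem_drop, List.getElem_drop] at hlt
      rw [List.length_drop] at hi
      have := hl.2.2 (u + i) (by omega) hlt
      rcases Finset.mem_insert.1 this with h | h
      · omega
      · have := hU _ h
        omega
    refine ⟨⟨⟨(l.take u).toFinset, ?_, hcard⟩, ⟨l.take u, ?_, rfl, ?_⟩⟩, ?_⟩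
    · refine lt_of_le_of_ne hsub ?_
      intro h
      rw [h] at hcard
      omega
    · exact hl.1.sublist (List.take_sublist _ _)
    · intro i hi hlt
      rw [List.getElem_take, List.getElem_take] at hlt
      rw [List.length_take] at hi
      refine (Finset.mem_insert.1 (hl.2.2 i (by omega) hlt)).resolve_left (by omega)
    · apply Subtype.ext
      dsimp only
      rw [hdrop, List.take_append_drop]

lemma ch_empty {P : Type*} [PartialOrder P] (ρ : P → ℕ) (q : P → Prop) :
    Ch ρ q ∅ = {∅} := by
  ext c
  constructor
  · rintro ⟨_, h, _⟩
    exact Finset.image_eq_empty.1 h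
  · rintro rfl
    exact ⟨by simp, by simp, by simp⟩

lemma ls_empty {m : ℕ} (A : Finset (Fin m)) : Ls A ∅ = {A.sort (· ≤ ·)} := by
  ext l
  constructor
  · rintro ⟨h1, h2, h3⟩
    have := sort_unique l h1 (fun i hi hlt => by simpa using h3 i hi hlt)
    rw [h2] at this
    exact this.symm
  · rintro rfl
    exact ⟨Finset.sort_nodup _ _, Finset.sort_toFinset _ _,
      fun i hi hlt => absurd hlt (sort_asc A i hi)⟩

lemma ch_ls {P : Type*} [PartialOrder P] (ρ : P → ℕ) (hρ : StrictMono ρ) (x : P) (m : ℕ)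
    (e : Set.Iic x ≃o Finset (Fin m)) (he : ∀ z : Set.Iic x, ρ z = (e z).card)
    (U : Finset ℕ) : ∀ y : Set.Iic x, (∀ a ∈ U, a < ρ y) →
      Nonempty (Ch ρ (fun z => z < y.1) U ≃ Ls (e y) U) := by
  induction U using Finset.induction_on_max with
  | empty =>
    intro y _
    rw [ch_empty, ls_empty]
    exact ⟨Equiv.ofUnique _ _⟩
  | insert u U hU ih =>
    intro y hy
    have hu : u < ρ y := hy u (Finset.mem_insert_self _ _)
    obtain ⟨e1⟩ := ch_equiv ρ hρ (fun z => z < y.1) u U hU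
    obtain ⟨e2⟩ := ls_equiv (e y) u U hU (by rw [← he]; exact hu)
    let f : {z : P // z < y.1 ∧ ρ z = u} ≃ {B : Finset (Fin m) // B < e y ∧ B.card = u} :=
      { toFun := fun z => ⟨e ⟨z.1, z.2.1.le.trans y.2⟩, e.lt_iff_lt.2 z.2.1, by
          rw [← he]; exact z.2.2⟩
        invFun := fun B => ⟨(e.symm B.1).1, by
          have : e.symm B.1 < y := by rw [e.symm_apply_lt]; exact B.2.1
          exact this, by rw [he, e.apply_symm_apply]; exact B.2.2⟩
        left_inv := fun z => by simp
        right_inv := fun B => by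
          apply Subtype.ext
          exact e.apply_symm_apply B.1 }
    have g : ∀ z : {z : P // z < y.1 ∧ ρ z = u},
        Nonempty (Ch ρ (fun w => w < y.1 ∧ w < z.1) U ≃ Ls (f z).1 U) := by
      intro z
      have : (fun w => w < y.1 ∧ w < z.1) = (fun w => w < z.1) := by
        funext w
        exact propext ⟨fun h => h.2, fun h => ⟨h.trans z.2.1, h⟩⟩
      rw [this]
      exact ih ⟨z.1, z.2.1.le.trans y.2⟩ (fun a ha => by
        have := hU a ha
        have := z.2.2
        dsimp only
        omega)
    exact ⟨e1.symm.trans ((Equiv.sigmaCongr f fun z => (g z).some).trans e2)⟩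

lemma permApp_succ {m : ℕ} (w : Equiv.Perm (Fin m)) (i : ℕ) (h : i < m) :
    permApp w (i + 1) = (w ⟨i, h⟩ : ℕ) + 1 := by
  unfold permApp
  rw [dif_pos (by simpa using h)]
  simp

lemma ls_perm {m : ℕ} (U : Finset ℕ) :
    Nonempty ({w : Equiv.Perm (Fin m) // descentSet w ⊆ U} ≃
      Ls (Finset.univ : Finset (Fin m)) U) := by
  have key : ∀ w : Equiv.Perm (Fin m), (descentSet w ⊆ U ↔ List.ofFn w ∈ Ls Finset.univ U) := by
    intro w
    constructor
    · intro h
      refine ⟨List.nodup_ofFn.2 w.injective, ?_, ?_⟩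
      · ext a
        simp only [List.mem_toFinset, List.mem_ofFn, Finset.mem_univ, iff_true]
        exact w.surjective a
      · intro i hi hlt
        rw [List.length_ofFn] at hi
        rw [List.getElem_ofFn, List.getElem_ofFn] at hlt
        apply h
        rw [descentSet, Finset.mem_filter, Finset.mem_Icc, permApp_succ w (i + 1) hi,
          permApp_succ w i (by omega)]
        refine ⟨by omega, ?_⟩
        have := Fin.lt_def.1 hlt
        omega
    · rintro ⟨_, _, h⟩ i hi
      rw [descentSet, Finset.mem_filter, Finset.mem_Icc] at hi
      obtain ⟨j, rfl⟩ : ∃ j, i = j + 1 := ⟨i - 1, by omega⟩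
      rw [permApp_succ w (j + 1) (by omega), permApp_succ w j (by omega)] at hi
      apply h j (by rw [List.length_ofFn]; omega)
      rw [List.getElem_ofFn, List.getElem_ofFn, Fin.lt_def]
      omega
  refine ⟨Equiv.ofBijective (fun w => ⟨List.ofFn w.1, (key w.1).1 w.2⟩) ⟨?_, ?_⟩⟩
  · intro w w' h
    have h := congrArg Subtype.val h
    apply Subtype.ext
    apply Equiv.ext
    intro a
    exact congrFun (List.ofFn_injective h) a
  · rintro ⟨l, hl⟩
    have hlen : l.length = m := by rw [ls_length hl]; simp
    let f : Fin m → Fin m := fun i => l.get (Fin.cast hlen.symm i)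
    have hinj : Function.Injective f :=
      (List.nodup_iff_injective_get.1 hl.1).comp (Fin.cast_injective _)
    have hw : List.ofFn (Equiv.ofBijective f (Finite.injective_iff_bijective.1 hinj)) = l := by
      apply List.ext_getElem
      · simp [hlen]
      · intro i h1 h2
        simp [f]
    refine ⟨⟨Equiv.ofBijective f (Finite.injective_iff_bijective.1 hinj), ?_⟩, ?_⟩
    · rw [key, hw]; exact hl
    · exact Subtype.ext hw

lemma mobius (T : Finset ℕ) : ∀ f : Finset ℕ → ℤ,
    ∑ U ∈ T.powerset, (-1 : ℤ) ^ (T.card - U.card) * ∑ V ∈ U.powerset, f V = f T := by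
  induction T using Finset.induction_on with
  | empty => intro f; simp
  | insert a T ha ih =>
    intro f
    rw [Finset.sum_powerset_insert ha, ← ih (fun V => f (insert a V)), ← Finset.sum_add_distrib]
    apply Finset.sum_congr rfl
    intro U hU
    have hU' := Finset.mem_powerset.1 hU
    have haU : a ∉ U := fun h => ha (hU' h)
    have hc := Finset.card_le_card hU'
    rw [Finset.sum_powerset_insert haU, Finset.card_insert_of_notMem ha,
      Finset.card_insert_of_notMem haU, Nat.add_sub_add_right,
      Nat.sub_add_comm hc, pow_succ]
    ring

lemma numDescent_sum (m : ℕ) (T : Finset ℕ) :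
    ∑ U ∈ T.powerset, (-1 : ℤ) ^ (T.card - U.card) *
      (Nat.card {w : Equiv.Perm (Fin m) // descentSet w ⊆ U} : ℤ) = (numDescentSet m T : ℤ) := by
  rw [← mobius T (fun T => (numDescentSet m T : ℤ))]
  apply Finset.sum_congr rfl
  intro U _
  congr 1
  have h1 : ∀ q : Equiv.Perm (Fin m) → Prop,
      Nat.card {w // q w} = (Finset.univ.filter q).card := by
    intro q
    rw [Nat.card_eq_fintype_card, Fintype.card_subtype]
  unfold numDescentSet
  simp only [h1]
  rw [Finset.card_eq_sum_card_fiberwise (f := descentSet) (t := U.powerset)]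
  · push_cast
    apply Finset.sum_congr rfl
    intro V hV
    congr 2
    ext w
    simp only [Finset.mem_filter, Finset.mem_univ, true_and]
    constructor
    · exact fun h => h.2
    · exact fun h => ⟨h ▸ Finset.mem_powerset.1 hV, h⟩
  · intro w hw
    simpa using hw


section poset

variable {P : Type*} [Fintype P] [PartialOrder P]

lemma exists_lower {a b : P} (h : a < b) : ∃ c, a ≤ c ∧ c ⋖ b := by
  obtain ⟨c, hc⟩ := exists_le_covBy_of_lt h
  exact ⟨c, hc⟩

lemma rk_strictMono (ρ : P → ℕ) (hρcov : ∀ a b : P, a ⋖ b → ρ b = ρ a + 1) :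
    StrictMono ρ := by
  intro a b
  induction b using WellFoundedLT.induction with
  | ind b ih =>
    intro h
    obtain ⟨c, hac, hcb⟩ := exists_lower h
    have h1 := hρcov c b hcb
    rcases hac.eq_or_lt with rfl | hac
    · omega
    · have := ih c hcb.lt hac
      omega

lemma rk_between (ρ : P → ℕ) (hρcov : ∀ a b : P, a ⋖ b → ρ b = ρ a + 1) (a b : P) (t : ℕ)
    (hab : a < b) (h1 : ρ a < t) (h2 : t < ρ b) : ∃ z, a < z ∧ z < b ∧ ρ z = t := by
  induction b using WellFoundedLT.induction with
  | ind b ih =>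
    obtain ⟨c, hac, hcb⟩ := exists_lower hab
    have h3 := hρcov c b hcb
    have hac' : a < c := by
      refine lt_of_le_of_ne hac ?_
      rintro rfl
      omega
    by_cases htc : ρ c = t
    · exact ⟨c, hac', hcb.lt, htc⟩
    · obtain ⟨z, hz1, hz2, hz3⟩ := ih c hcb.lt hac' (by omega)
      exact ⟨z, hz1, hz2.trans hcb.lt, hz3⟩

variable [BoundedOrder P]

lemma rk_smul {G : Type*} [Group G] [MulAction G P]
    (hact : ∀ (g : G) (x y : P), x ≤ y ↔ g • x ≤ g • y)
    (ρ : P → ℕ) (hρcov : ∀ a b : P, a ⋖ b → ρ b = ρ a + 1) (g : G) (x : P) :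
    ρ (g • x) = ρ x := by
  let e : P ≃o P := ⟨MulAction.toPerm g, fun {a b} => (hact g a b).symm⟩
  have he : ∀ x, g • x = e x := fun _ => rfl
  induction x using WellFoundedLT.induction with
  | ind x ih =>
    by_cases hx : x = ⊥
    · rw [hx, he, map_bot]
    · obtain ⟨c, _, hc⟩ := exists_lower (bot_lt_iff_ne_bot.2 hx)
      have h1 : g • c ⋖ g • x := by
        rw [he, he]
        exact (apply_covBy_apply_iff e).2 hc
      rw [hρcov _ _ hc, hρcov _ _ h1, ih c hc.lt]

lemma rk_card (ρ : P → ℕ) (hρbot : ρ ⊥ = 0) (hρcov : ∀ a b : P, a ⋖ b → ρ b = ρ a + 1)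
    (x : P) (m : ℕ) (e : Set.Iic x ≃o Finset (Fin m)) (z : Set.Iic x) :
    ρ z = (e z).card := by
  have key : ∀ s : Finset (Fin m), ρ (e.symm s) = s.card := by
    intro s
    induction s using Finset.induction_on with
    | empty =>
      have : e.symm ∅ = ⊥ := map_bot e.symm
      rw [this]
      exact hρbot
    | insert a s ha ih =>
      have h1 : s ⋖ insert a s := Finset.covBy_insert ha
      have h2 : e.symm s ⋖ e.symm (insert a s) := (apply_covBy_apply_iff e.symm).2 h1
      have h3 : (e.symm s : P) ⋖ (e.symm (insert a s) : P) := by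
        refine ⟨h2.lt, fun c hc1 hc2 => ?_⟩
        exact h2.2 (c := ⟨c, hc2.le.trans (e.symm (insert a s)).2⟩) hc1 hc2
      rw [hρcov _ _ h3, ih, Finset.card_insert_of_notMem ha]
  have := key (e z)
  rwa [e.symm_apply_apply] at this

lemma gAlpha_eq {G : Type*} [Group G] [MulAction G P]
    (hact : ∀ (g : G) (x y : P), x ≤ y ↔ g • x ≤ g • y)
    (n : ℕ) (ρ : P → ℕ) (hρbot : ρ ⊥ = 0) (hρtop : ρ ⊤ = n + 1)
    (hρcov : ∀ a b : P, a ⋖ b → ρ b = ρ a + 1) (g : G) (T : Finset ℕ)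
    (hT : T ⊆ Finset.Icc 1 n) :
    gAlpha ρ (fun (g : G) (x : P) => g • x) T g =
      (Nat.card (Ch ρ (fun z : P => g • z = z) T) : ℤ) := by
  have hmono := rk_strictMono ρ hρcov
  have hT' : ∀ t ∈ T, 1 ≤ t ∧ t ≤ n := fun t ht => Finset.mem_Icc.1 (hT ht)
  let e : P ≃o P := ⟨MulAction.toPerm g, fun {a b} => (hact g a b).symm⟩
  have hgbot : g • (⊥ : P) = ⊥ := map_bot e
  have hgtop : g • (⊤ : P) = ⊤ := map_top e
  have huniq : ∀ C : Set P, IsChain (· ≤ ·) C → ∀ x ∈ C, ∀ y ∈ C, ρ x = ρ y → x = y := by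
    intro C hC x hx y hy hxy
    by_contra hne
    rcases hC hx hy hne with h | h
    · have := hmono (lt_of_le_of_ne h hne)
      omega
    · have := hmono (lt_of_le_of_ne h (Ne.symm hne))
      omega
  unfold gAlpha
  rw [← Nat.card_coe_set_eq]
  congr 1
  symm
  refine Nat.card_congr (Equiv.ofBijective
    (fun c => ⟨(c.1 : Set P) ∪ {⊥, ⊤}, ⟨?_, ?_, ?_⟩, ?_⟩) ⟨?_, ?_⟩)
  · obtain ⟨c, hc1, hc2, hc3⟩ := c
    apply Set.union_subset_union_left
    intro x hx
    change ρ x ∈ T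
    rw [← hc2]
    exact Finset.mem_image_of_mem ρ hx
  · obtain ⟨c, hc1, hc2, hc3⟩ := c
    intro x hx y hy hxy
    rcases hx with hx | rfl | rfl
    · rcases hy with hy | rfl | rfl
      · exact hc1 hx hy hxy
      · exact Or.inr bot_le
      · exact Or.inl le_top
    · exact Or.inl bot_le
    · exact Or.inr le_top
  · obtain ⟨c, hc1, hc2, hc3⟩ := c
    intro D hD hDc hcD
    apply Set.Subset.antisymm hcD
    intro d hd
    rcases hD hd with h | h
    · left
      have h : ρ d ∈ T := h
      rw [← hc2] at h
      obtain ⟨y, hy, hyd⟩ := Finset.mem_image.1 h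
      have := huniq D hDc y (hcD (Or.inl hy)) d hd hyd
      rw [← this]
      exact hy
    · exact Or.inr h
  · obtain ⟨c, hc1, hc2, hc3⟩ := c
    dsimp only
    have : ∀ x ∈ (c : Set P) ∪ {⊥, ⊤}, g • x = x := by
      rintro x (hx | rfl | rfl)
      · exact hc3 x hx
      · exact hgbot
      · exact hgtop
    rw [Set.image_congr this, Set.image_id']
  · rintro ⟨c, hc1, hc2, hc3⟩ ⟨c', hc1', hc2', hc3'⟩ h
    have h : (c : Set P) ∪ {⊥, ⊤} = (c' : Set P) ∪ {⊥, ⊤} := congrArg Subtype.val h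
    have key : ∀ d : Finset P, d.image ρ = T → ∀ x, x ∈ d ↔
        x ∈ (d : Set P) ∪ {⊥, ⊤} ∧ ρ x ∈ T := by
      intro d hd x
      constructor
      · intro hx
        exact ⟨Or.inl hx, hd ▸ Finset.mem_image_of_mem ρ hx⟩
      · rintro ⟨hx | rfl | rfl, h⟩
        · exact hx
        · have := hT' _ h
          omega
        · have := hT' _ h
          omega
    apply Subtype.ext
    ext x
    dsimp only
    rw [key c hc2, key c' hc2', h]
  · rintro ⟨C, ⟨hC1, hC2, hC3⟩, hC4⟩
    have hadd : ∀ z ∈ rankSel ρ T, (∀ y ∈ C, z ≠ y → z ≤ y ∨ y ≤ z) → z ∈ C := by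
      intro z hz h
      have := hC3 (insert z C) (Set.insert_subset hz hC1) (hC2.insert h) (Set.subset_insert _ _)
      rw [this]
      exact Set.mem_insert _ _
    have hbot : ⊥ ∈ C := hadd ⊥ (Or.inr (Or.inl rfl)) fun y _ _ => Or.inl bot_le
    have htop : ⊤ ∈ C := hadd ⊤ (Or.inr (Or.inr rfl)) fun y _ _ => Or.inr le_top
    have hlt : ∀ x ∈ C, ∀ y ∈ C, ρ x < ρ y → x < y := by
      intro x hx y hy hxy
      have hne : x ≠ y := by rintro rfl; omega
      rcases hC2 hx hy hne with h | h
      · exact lt_of_le_of_ne h hne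
      · have := hmono (lt_of_le_of_ne h hne.symm)
        omega
    have hall : ∀ t ∈ T, ∃ x ∈ C, ρ x = t := by
      intro t ht
      by_contra! hno
      have htn := hT' t ht
      obtain ⟨a, ha, hamax⟩ := Set.exists_max_image {x ∈ C | ρ x < t} ρ (Set.toFinite _)
        ⟨⊥, hbot, by omega⟩
      obtain ⟨b, hb, hbmin⟩ := Set.exists_min_image {x ∈ C | t < ρ x} ρ (Set.toFinite _)
        ⟨⊤, htop, by omega⟩
      obtain ⟨z, hz1, hz2, hz3⟩ := rk_between ρ hρcov a b t
        (hlt a ha.1 b hb.1 (ha.2.trans hb.2)) ha.2 hb.2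
      refine hno z (hadd z (Or.inl (by change ρ z ∈ T; rw [hz3]; exact ht)) ?_) hz3
      intro y hy _
      rcases lt_trichotomy (ρ y) t with h | h | h
      · right
        have h1 := hamax y ⟨hy, h⟩
        rcases h1.eq_or_lt with h1 | h1
        · rw [huniq C hC2 y hy a ha.1 h1]
          exact hz1.le
        · exact (hlt y hy a ha.1 h1).le.trans hz1.le
      · exact absurd h (hno y hy)
      · left
        have h1 := hbmin y ⟨hy, h⟩
        rcases h1.eq_or_lt with h1 | h1
        · rw [← huniq C hC2 b hb.1 y hy h1]
          exact hz2.le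
        · exact hz2.le.trans (hlt b hb.1 y hy h1).le
    refine ⟨⟨Finset.univ.filter (fun x => x ∈ C ∧ ρ x ∈ T), ?_, ?_, ?_⟩, ?_⟩
    · refine hC2.mono ?_
      intro x hx
      simp only [Finset.coe_filter, Set.mem_ofPred_eq] at hx
      exact hx.2.1
    · ext t
      simp only [Finset.mem_image, Finset.mem_filter, Finset.mem_univ, true_and]
      constructor
      · rintro ⟨x, hx, rfl⟩
        exact hx.2
      · intro ht
        obtain ⟨x, hx, rfl⟩ := hall t ht
        exact ⟨x, ⟨hx, ht⟩, rfl⟩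
    · intro x hx
      simp only [Finset.mem_filter, Finset.mem_univ, true_and] at hx
      have h1 : g • x ∈ C := by
        rw [← hC4]
        exact Set.mem_image_of_mem _ hx.1
      exact huniq C hC2 _ h1 x hx.1 (rk_smul hact ρ hρcov g x)
    · apply Subtype.ext
      ext x
      simp only [Finset.coe_filter, Finset.mem_univ, true_and]
      constructor
      · rintro (h | rfl | rfl)
        · exact h.1
        · exact hbot
        · exact htop
      · intro hx
        rcases hC1 hx with h | h
        · exact Or.inl ⟨hx, h⟩
        · exact Or.inr h

lemma gAlpha_insert {G : Type*} [Group G] [MulAction G P]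
    (hact : ∀ (g : G) (x y : P), x ≤ y ↔ g • x ≤ g • y)
    (hgood : ∀ (g : G) (y : P), y ≠ ⊤ → g • y = y → ∀ x : P, x ≤ y → g • x = x)
    (n : ℕ) (ρ : P → ℕ) (hρbot : ρ ⊥ = 0) (hρtop : ρ ⊤ = n + 1)
    (hρcov : ∀ a b : P, a ⋖ b → ρ b = ρ a + 1)
    (hsimp : ∀ x : P, x ≠ ⊤ → ∃ m : ℕ, Nonempty (Set.Iic x ≃o Finset (Fin m)))
    (g : G) (t : ℕ) (U : Finset ℕ) (hU : ∀ a ∈ U, a < t)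
    (hT : insert t U ⊆ Finset.Icc 1 n) :
    gAlpha ρ (fun (g : G) (x : P) => g • x) (insert t U) g =
      gAlpha ρ (fun (g : G) (x : P) => g • x) {t} g *
        (Nat.card {w : Equiv.Perm (Fin t) // descentSet w ⊆ U} : ℤ) := by
  have hmono := rk_strictMono ρ hρcov
  have ht : t ∈ Finset.Icc 1 n := hT (Finset.mem_insert_self _ _)
  rw [gAlpha_eq hact n ρ hρbot hρtop hρcov g _ hT,
    gAlpha_eq hact n ρ hρbot hρtop hρcov g {t} (by simpa using ht)]
  obtain ⟨e1⟩ := ch_equiv ρ hmono (fun z : P => g • z = z) t U hU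
  obtain ⟨e2⟩ := ch_equiv ρ hmono (fun z : P => g • z = z) t ∅ (by simp)
  have h1 : ∀ y : {y : P // g • y = y ∧ ρ y = t},
      Nonempty (Ch ρ (fun z => g • z = z ∧ z < y.1) U ≃
        {w : Equiv.Perm (Fin t) // descentSet w ⊆ U}) := by
    rintro ⟨y, hy, hyt⟩
    have hytop : y ≠ ⊤ := by
      rintro rfl
      have := Finset.mem_Icc.1 ht
      omega
    have : (fun z => g • z = z ∧ z < y) = (fun z => z < y) := by
      funext z
      exact propext ⟨fun h => h.2, fun h => ⟨hgood g y hytop hy z h.le, h⟩⟩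
    dsimp only
    rw [this]
    obtain ⟨m, ⟨e⟩⟩ := hsimp y hytop
    have hcard := rk_card ρ hρbot hρcov y m e
    have he : e ⟨y, le_rfl⟩ = Finset.univ := map_top e
    have hm : m = t := by
      have := hcard ⟨y, le_rfl⟩
      rw [he, Finset.card_univ, Fintype.card_fin] at this
      exact this.symm.trans hyt
    subst hm
    obtain ⟨e3⟩ := ch_ls ρ hmono y m e hcard U ⟨y, le_rfl⟩ (fun a ha => by
      have := hU a ha
      dsimp only
      omega)
    obtain ⟨e4⟩ := ls_perm (m := m) U
    rw [he] at e3
    exact ⟨e3.trans e4.symm⟩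
  have h2 : ∀ y : {y : P // g • y = y ∧ ρ y = t},
      Nonempty (Ch ρ (fun z => g • z = z ∧ z < y.1) ∅ ≃ Unit) := by
    intro y
    rw [ch_empty]
    exact ⟨Equiv.ofUnique _ _⟩
  rw [Nat.card_congr (e1.symm.trans (Equiv.sigmaEquivProdOfEquiv fun y => (h1 y).some)),
    show ({t} : Finset ℕ) = insert t ∅ from rfl,
    Nat.card_congr (e2.symm.trans (Equiv.sigmaEquivProdOfEquiv fun y => (h2 y).some)),
    Nat.card_prod, Nat.card_prod]
  simp

lemma gAlpha_empty {G : Type*} [Group G] [MulAction G P]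
    (hact : ∀ (g : G) (x y : P), x ≤ y ↔ g • x ≤ g • y)
    (n : ℕ) (ρ : P → ℕ) (hρbot : ρ ⊥ = 0) (hρtop : ρ ⊤ = n + 1)
    (hρcov : ∀ a b : P, a ⋖ b → ρ b = ρ a + 1) (g : G) :
    gAlpha ρ (fun (g : G) (x : P) => g • x) ∅ g = 1 := by
  rw [gAlpha_eq hact n ρ hρbot hρtop hρcov g ∅ (by simp), ch_empty]
  simp

lemma sort_insert_max (s : ℕ) (S : Finset ℕ) (hs : ∀ a ∈ S, a < s) :
    (insert s S).sort (· ≤ ·) = S.sort (· ≤ ·) ++ [s] := by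
  have h1 : (S.sort (· ≤ ·) ++ [s]).toFinset = insert s S := by
    ext a; simp
  rw [← h1]
  refine (List.toFinset_sort (· ≤ ·) ?_).2 ?_
  · refine List.Nodup.append (Finset.sort_nodup _ _) (by simp) ?_
    intro a ha hb
    simp only [Finset.mem_sort, List.mem_singleton] at ha hb
    have := hs a ha
    omega
  · rw [List.pairwise_append]
    refine ⟨Finset.pairwise_sort _ _, by simp, ?_⟩
    intro a ha b hb
    simp only [Finset.mem_sort, List.mem_singleton] at ha hb
    have := hs a ha
    omega

lemma sElt_insert_lt (n s : ℕ) (S : Finset ℕ) (hs : ∀ a ∈ S, a < s) (j : ℕ) (hj : j < S.card) :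
    sElt n (insert s S) (j + 1) = sElt n S (j + 1) := by
  have : s ∉ S := fun h => (hs s h).false
  unfold sElt
  have h1 : j + 1 ≤ (insert s S).card := by rw [Finset.card_insert_of_notMem this]; omega
  have h2 : j + 1 ≤ S.card := hj
  simp only [Nat.add_eq_zero_iff, one_ne_zero, and_false, if_false, if_pos h1, if_pos h2]
  rw [sort_insert_max s S hs,
    List.getD_append _ _ _ _ (by simpa using hj)]

lemma sElt_insert_last (n s : ℕ) (S : Finset ℕ) (hs : ∀ a ∈ S, a < s) :
    sElt n (insert s S) (S.card + 1) = s := by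
  have : s ∉ S := fun h => (hs s h).false
  unfold sElt
  rw [if_neg (by omega),
    if_pos (by rw [Finset.card_insert_of_notMem this]), sort_insert_max s S hs,
    List.getD_append_right _ _ _ _ (by simp)]
  simp

lemma sElt_mem (n : ℕ) (S : Finset ℕ) (j : ℕ) (hj : j < S.card) :
    sElt n S (j + 1) ∈ S := by
  unfold sElt
  rw [if_neg (by omega), if_pos (by omega), ← Finset.mem_sort (· ≤ ·),
    List.getD_eq_getElem _ _ (by simpa using hj)]
  exact List.getElem_mem _

end poset

end Stmt3

/-- **Theorem 3.1, Eq. (6)**: for a good action of a group `G` on a finite graded poset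
`P` of rank `n+1` such that `P ∖ {⊤}` is simplicial,
`β_P(S) = (-1)^k · 1_G + Σ_{i=1}^k (-1)^{k-i} b_{s_i}({s_1,…,s_{i-1}}) · α_P({s_i})`. -/
theorem statement3 {P : Type*} [Fintype P] [PartialOrder P] [BoundedOrder P]
    {G : Type*} [Group G] [MulAction G P]
    (hact : ∀ (g : G) (x y : P), x ≤ y ↔ g • x ≤ g • y)
    (hgood : ∀ (g : G) (y : P), y ≠ ⊤ → g • y = y → ∀ x : P, x ≤ y → g • x = x)
    (n : ℕ) (ρ : P → ℕ) (hρbot : ρ ⊥ = 0) (hρtop : ρ ⊤ = n + 1)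
    (hρcov : ∀ a b : P, a ⋖ b → ρ b = ρ a + 1)
    (hsimp : ∀ x : P, x ≠ ⊤ → ∃ m : ℕ, Nonempty (Set.Iic x ≃o Finset (Fin m)))
    (S : Finset ℕ) (hS : S ⊆ Finset.Icc 1 n) :
    ∀ g : G, gBeta ρ (fun g x => g • x) S g =
      (-1 : ℤ) ^ S.card +
        ∑ j ∈ Finset.range S.card,
          (-1 : ℤ) ^ (S.card - 1 - j) *
            (numDescentSet (sElt n S (j + 1)) (S.filter (· < sElt n S (j + 1))) : ℤ) *
            gAlpha ρ (fun g x => g • x) {sElt n S (j + 1)} g := by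
  intro g
  induction S using Finset.induction_on_max with
  | empty =>
    simp [gBeta, Stmt3.gAlpha_empty hact n ρ hρbot hρtop hρcov g]
  | insert s S hs ih =>
    have hsS : s ∉ S := fun h => (hs s h).false
    have ih := ih ((Finset.subset_insert s S).trans hS)
    have hcard := Finset.card_insert_of_notMem hsS
    have hrec : gBeta ρ (fun (g : G) (x : P) => g • x) (insert s S) g =
        - gBeta ρ (fun (g : G) (x : P) => g • x) S g +
          gAlpha ρ (fun (g : G) (x : P) => g • x) {s} g * (numDescentSet s S : ℤ) := by
      rw [← Stmt3.numDescent_sum]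
      unfold gBeta
      rw [Finset.sum_powerset_insert hsS, Finset.mul_sum, ← Finset.sum_neg_distrib]
      congr 1
      · apply Finset.sum_congr rfl
        intro U hU
        have hc := Finset.card_le_card (Finset.mem_powerset.1 hU)
        rw [hcard, Nat.sub_add_comm hc, pow_succ]
        ring
      · apply Finset.sum_congr rfl
        intro U hU
        have hU' := Finset.mem_powerset.1 hU
        have hsU : s ∉ U := fun h => hsS (hU' h)
        rw [Stmt3.gAlpha_insert hact hgood n ρ hρbot hρtop hρcov hsimp g s U
          (fun a ha => hs a (hU' ha)) ((Finset.insert_subset_insert s hU').trans hS),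
          hcard, Finset.card_insert_of_notMem hsU, Nat.add_sub_add_right]
        ring
    rw [hrec, ih, hcard, Finset.sum_range_succ, Stmt3.sElt_insert_last n s S hs]
    have hfil : (insert s S).filter (· < s) = S := by
      ext a
      simp only [Finset.mem_filter, Finset.mem_insert]
      constructor
      · rintro ⟨rfl | h, h'⟩
        · omega
        · exact h
      · exact fun h => ⟨Or.inr h, hs a h⟩
    have hsum : ∑ j ∈ Finset.range S.card,
          (-1 : ℤ) ^ (S.card + 1 - 1 - j) *
            (numDescentSet (sElt n (insert s S) (j + 1))
              ((insert s S).filter (· < sElt n (insert s S) (j + 1))) : ℤ) *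
            gAlpha ρ (fun (g : G) (x : P) => g • x) {sElt n (insert s S) (j + 1)} g =
        - ∑ j ∈ Finset.range S.card,
          (-1 : ℤ) ^ (S.card - 1 - j) *
            (numDescentSet (sElt n S (j + 1)) (S.filter (· < sElt n S (j + 1))) : ℤ) *
            gAlpha ρ (fun (g : G) (x : P) => g • x) {sElt n S (j + 1)} g := by
      rw [← Finset.sum_neg_distrib]
      apply Finset.sum_congr rfl
      intro j hj
      have hj := Finset.mem_range.1 hj
      rw [Stmt3.sElt_insert_lt n s S hs j hj]
      have hlt := hs _ (Stmt3.sElt_mem n S j hj)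
      rw [Finset.filter_insert, if_neg (by omega),
        show S.card + 1 - 1 - j = (S.card - 1 - j) + 1 by omega, pow_succ]
      ring
    rw [hsum, hfil, show S.card + 1 - 1 - S.card = 0 by omega, pow_succ]
    ring
end
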